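/- arXiv:1307.2604 — 2 statements merged into one kernel-verified Lean document; each statement's English description precedes it below -/
import Mathlib

section
/- If E ⊆ ℝ² is a locally connected continuum not separated by any point, and R is a connected component of ℝ² \ E, then ∂R is homeomorphic to the unit circle. -/
open Set

/-- The plane. -/
abbrev Plane := EuclideanSpace ℝ (Fin 2)

/-- The unit circle in the plane. -/
abbrev unitCircle : Set Plane := Metric.sphere (0 : Plane) 1


open Filter Topology

/-- `g` has a continuous logarithm on `K`. -/
def HasLog (g : ℂ → ℂ) (K : Set ℂ) : Prop :=
  ∃ L : ℂ → ℂ, ContinuousOn L K ∧ ∀ z ∈ K, Complex.exp (L z) = g z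

lemma HasLog.mono {g : ℂ → ℂ} {K K' : Set ℂ} (h : HasLog g K) (hK : K' ⊆ K) : HasLog g K' := by
  obtain ⟨L, hL, hL'⟩ := h
  exact ⟨L, hL.mono hK, fun z hz => hL' z (hK hz)⟩

lemma HasLog.congr {g g' : ℂ → ℂ} {K : Set ℂ} (h : HasLog g K) (hK : ∀ z ∈ K, g z = g' z) :
    HasLog g' K := by
  obtain ⟨L, hL, hL'⟩ := h
  exact ⟨L, hL, fun z hz => (hL' z hz).trans (hK z hz)⟩

lemma HasLog.mul {g g' : ℂ → ℂ} {K : Set ℂ} (h : HasLog g K) (h' : HasLog g' K) :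
    HasLog (fun z => g z * g' z) K := by
  obtain ⟨L, hL, hL1⟩ := h
  obtain ⟨M, hM, hM1⟩ := h'
  exact ⟨fun z => L z + M z, hL.add hM, fun z hz => by rw [Complex.exp_add, hL1 z hz, hM1 z hz]⟩

lemma HasLog.inv {g : ℂ → ℂ} {K : Set ℂ} (h : HasLog g K) :
    HasLog (fun z => (g z)⁻¹) K := by
  obtain ⟨L, hL, hL1⟩ := h
  exact ⟨fun z => - L z, hL.neg, fun z hz => by rw [Complex.exp_neg, hL1 z hz]⟩

lemma hasLog_of_slit {g : ℂ → ℂ} {K : Set ℂ} (hg : ContinuousOn g K)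
    (h : ∀ z ∈ K, g z ∈ Complex.slitPlane) : HasLog g K :=
  ⟨fun z => Complex.log (g z), hg.clog h,
    fun z hz => Complex.exp_log (Complex.slitPlane_ne_zero (h z hz))⟩

lemma exp_eq_one_small {w : ℂ} (h : Complex.exp w = 1) (hw : ‖w‖ < 1) : w = 0 := by
  obtain ⟨n, rfl⟩ := Complex.exp_eq_one_iff.1 h
  have hpi := Real.pi_gt_three
  have h1 : ‖(n : ℂ) * (2 * Real.pi * Complex.I)‖ = |(n : ℝ)| * (2 * Real.pi) := by
    simp [abs_of_pos Real.pi_pos]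
  rw [h1] at hw
  have : |(n : ℝ)| < 1 := by nlinarith [abs_nonneg (n : ℝ)]
  have h2 : |n| < 1 := by exact_mod_cast this
  have : n = 0 := by simpa using h2
  simp [this]

/-- Continuous functions with constant exponential on a preconnected set are constant. -/
lemma const_of_exp {h : ℂ → ℂ} {S : Set ℂ} {c : ℂ} (hS : IsPreconnected S)
    (hc : ContinuousOn h S) (he : ∀ z ∈ S, Complex.exp (h z) = c) {x y : ℂ}
    (hx : x ∈ S) (hy : y ∈ S) : h x = h y := by
  refine hS.induction₂ (fun x y => h x = h y) ?_ (fun x y z _ _ _ h1 h2 => h1.trans h2)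
    (fun x y _ _ h1 => h1.symm) hx hy
  intro z hz
  have h1 : ∀ᶠ w in 𝓝[S] z, h w ∈ Metric.ball (h z) 1 :=
    (hc z hz).eventually (Metric.ball_mem_nhds _ one_pos)
  filter_upwards [h1, self_mem_nhdsWithin] with w hw hwS
  have h2 : Complex.exp (h w - h z) = 1 := by
    rw [Complex.exp_sub, he w hwS, he z hz, div_self]
    rw [← he z hz]; exact Complex.exp_ne_zero _
  have := exp_eq_one_small h2 (by simpa [dist_eq_norm] using hw)
  exact (sub_eq_zero.1 this).symm

/-- Gluing logarithms. -/
lemma HasLog.union {g : ℂ → ℂ} {A B : Set ℂ} (hA : HasLog g A) (hB : HasLog g B)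
    (cA : IsClosed A) (cB : IsClosed B) (hAB : IsPreconnected (A ∩ B)) : HasLog g (A ∪ B) := by
  obtain ⟨L, hL, hL1⟩ := hA
  obtain ⟨M, hM, hM1⟩ := hB
  obtain ⟨c, hc1, hc⟩ : ∃ c : ℂ, Complex.exp c = 1 ∧ ∀ z ∈ A ∩ B, L z = M z + c := by
    by_cases hne : (A ∩ B).Nonempty
    · obtain ⟨z0, hz0⟩ := hne
      have key : ∀ z ∈ A ∩ B, Complex.exp (L z - M z) = 1 := by
        intro z hz
        rw [Complex.exp_sub, hL1 z hz.1, hM1 z hz.2, div_self]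
        rw [← hL1 z hz.1]; exact Complex.exp_ne_zero _
      refine ⟨L z0 - M z0, key z0 hz0, fun z hz => ?_⟩
      have := const_of_exp (h := fun z => L z - M z) hAB
        ((hL.mono inter_subset_left).sub (hM.mono inter_subset_right)) key hz hz0
      linear_combination this
    · refine ⟨0, by simp, fun z hz => (hne ⟨z, hz⟩).elim⟩
  classical
  let N : ℂ → ℂ := fun z => if z ∈ A then L z else M z + c
  have hNA : ∀ z ∈ A, N z = L z := fun z hz => by simp [N, hz]
  have hNB : ∀ z ∈ B, N z = M z + c := fun z hz => by
    by_cases hzA : z ∈ A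
    · rw [hNA z hzA, hc z ⟨hzA, hz⟩]
    · simp [N, hzA]
  refine ⟨N, ?_, ?_⟩
  · exact ContinuousOn.union_of_isClosed (hL.congr hNA) ((hM.add continuousOn_const).congr hNB) cA cB
  · rintro z (hz | hz)
    · rw [hNA z hz, hL1 z hz]
    · rw [hNB z hz, Complex.exp_add, hc1, mul_one, hM1 z hz]

/-- every nonvanishing continuous function on the plane has a logarithm -/
lemma hasLog_univ {g : ℂ → ℂ} (hg : Continuous g) (h0 : ∀ z, g z ≠ 0) : HasLog g univ := by
  obtain ⟨f, hf, -⟩ := Complex.isCoveringMapOn_exp.existsUnique_continuousMap_lifts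
    ⟨g, hg⟩ (a₀ := 0) (e₀ := Complex.log (g 0)) (Complex.exp_log (h0 0)) (fun z => h0 z)
  refine ⟨f, f.continuous.continuousOn, fun z _ => ?_⟩
  exact congrFun hf.2 z

/-- points in the same component of the complement give a logarithm -/
lemma hasLog_of_joined {K S : Set ℂ} (hK : IsClosed K) (hS : IsPreconnected S) (hSK : S ⊆ Kᶜ)
    {x y : ℂ} (hx : x ∈ S) (hy : y ∈ S) : HasLog (fun z => (z - x) / (z - y)) K := by
  have hne : ∀ z ∈ K, ∀ w ∈ S, z - w ≠ 0 := by
    intro z hz w hw h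
    rw [sub_eq_zero.1 h] at hz
    exact hSK hw hz
  refine hS.induction₂ (fun x y => HasLog (fun z => (z - x) / (z - y)) K) ?_ ?_ ?_ hx hy
  · intro x hx
    obtain ⟨ε, hε, hb⟩ := Metric.isOpen_iff.1 hK.isOpen_compl x (hSK hx)
    have : ∀ᶠ w in 𝓝[S] x, w ∈ Metric.ball x (ε / 2) :=
      nhdsWithin_le_nhds (Metric.ball_mem_nhds _ (by positivity))
    filter_upwards [this, self_mem_nhdsWithin] with w hw hwS
    refine hasLog_of_slit ?_ ?_
    · exact (continuousOn_id.sub continuousOn_const).div (continuousOn_id.sub continuousOn_const)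
        (fun z hz => hne z hz w hwS)
    · intro z hz
      have h1 : (z - x) / (z - w) = 1 + (w - x) / (z - w) := by
        field_simp [hne z hz w hwS]; ring
      rw [h1]
      apply Complex.mem_slitPlane_of_norm_lt_one
      have h2 : ε ≤ dist z x := by
        by_contra hlt
        exact hb (Metric.mem_ball.2 (not_le.1 hlt)) hz
      have h3 : dist w x < ε / 2 := hw
      have h4 : dist z x ≤ dist z w + dist w x := dist_triangle _ _ _
      rw [norm_div, ← dist_eq_norm, ← dist_eq_norm, div_lt_one (by linarith)]
      linarith
  · intro x y z _ hy _ h1 h2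
    refine (h1.mul h2).congr fun w hw => ?_
    have := hne w hw y hy
    field_simp
  · intro x y _ _ h1
    refine h1.inv.congr fun w hw => ?_
    simp

/-- `z - x` has no logarithm on a circle around `x`. -/
lemma not_hasLog_sphere {x : ℂ} {r : ℝ} (hr : 0 < r) :
    ¬ HasLog (fun z => z - x) (Metric.sphere x r) := by
  rintro ⟨L, hL, hL1⟩
  have hm : ∀ t : ℂ, t ∈ (fun s : ℝ => (s : ℂ)) '' univ → x + r * Complex.exp (t * Complex.I) ∈ Metric.sphere x r := by
    rintro _ ⟨t, -, rfl⟩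
    simp [Complex.norm_exp_ofReal_mul_I, abs_of_pos hr]
  have hS : IsPreconnected ((fun s : ℝ => (s : ℂ)) '' univ) :=
    isPreconnected_univ.image _ Complex.continuous_ofReal.continuousOn
  have := const_of_exp (h := fun t => L (x + r * Complex.exp (t * Complex.I)) - t * Complex.I)
    (c := r) hS ?_ ?_ (x := ((0 : ℝ) : ℂ)) (y := ((2 * Real.pi : ℝ) : ℂ)) ⟨0, trivial, rfl⟩ ⟨_, trivial, rfl⟩
  · simp only [Complex.ofReal_zero, zero_mul, Complex.exp_zero, Complex.ofReal_mul, Complex.ofReal_ofNat,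
      Complex.exp_two_pi_mul_I, sub_zero] at this
    have h2 : (2 * (Real.pi : ℂ) * Complex.I) = 0 := by linear_combination this
    exact Complex.two_pi_I_ne_zero h2
  · exact (hL.comp (Continuous.continuousOn (by fun_prop)) hm).sub (Continuous.continuousOn (by fun_prop))
  · intro t ht
    rw [Complex.exp_sub, hL1 _ (hm t ht)]
    have := Complex.exp_ne_zero (t * Complex.I)
    field_simp
    ring


/-- A preconnected set meeting `O` and its complement meets the frontier of `O`. -/
lemma frontier_inter {O S : Set ℂ} (hS : IsPreconnected S) {x y : ℂ}
    (hx : x ∈ S) (hy : y ∈ S) (hxO : x ∈ O) (hyO : y ∉ O) : ∃ z ∈ S, z ∈ frontier O := by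
  by_contra hcon
  push Not at hcon
  have hcov : S ⊆ interior O ∪ (closure O)ᶜ := by
    intro z hz
    by_cases h1 : z ∈ interior O
    · exact Or.inl h1
    · exact Or.inr fun h2 => hcon z hz ⟨h2, h1⟩
  obtain ⟨z, -, hz1, hz2⟩ := hS _ _ isOpen_interior isClosed_closure.isOpen_compl hcov
    ⟨x, hx, (hcov hx).resolve_right fun h => h (subset_closure hxO)⟩
    ⟨y, hy, (hcov hy).resolve_left fun h => hyO (interior_subset h)⟩
  exact hz2 (subset_closure (interior_subset hz1))

/-- The frontier of a component of an open set is in the complement. -/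
lemma frontier_comp {α : Type*} [TopologicalSpace α] [LocallyConnectedSpace α] {K : Set α}
    (hK : IsClosed K) (x : α) :
    frontier (connectedComponentIn Kᶜ x) ⊆ K := by
  intro z hz
  by_contra hzK
  have hzo : IsOpen (connectedComponentIn Kᶜ z) := hK.isOpen_compl.connectedComponentIn
  have hxo : IsOpen (connectedComponentIn Kᶜ x) := hK.isOpen_compl.connectedComponentIn
  obtain ⟨w, hw1, hw2⟩ := mem_closure_iff.1 (frontier_subset_closure hz) _ hzo
    (mem_connectedComponentIn hzK)
  have h1 := connectedComponentIn_eq hw1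
  have h2 := connectedComponentIn_eq hw2
  have : z ∈ connectedComponentIn Kᶜ x := by
    rw [h2, ← h1]; exact mem_connectedComponentIn hzK
  rw [hxo.frontier_eq] at hz
  exact hz.2 this

lemma one_lt_rank_C : 1 < Module.rank ℝ ℂ := by simp

lemma preconn_compl_closedBall (r : ℝ) (hr : 0 < r) : IsPreconnected {z : ℂ | r < ‖z‖} := by
  have h1 : IsPreconnected ((Ioi r) ×ˢ (Metric.sphere (0 : ℂ) 1)) :=
    isPreconnected_Ioi.prod (isPreconnected_sphere one_lt_rank_C _ _)
  have h2 := h1.image (fun p : ℝ × ℂ => (p.1 : ℂ) * p.2) (Continuous.continuousOn (by fun_prop))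
  convert h2 using 1
  ext z
  constructor
  · intro hz
    have hz : r < ‖z‖ := hz
    have h0 : (‖z‖ : ℂ) ≠ 0 := by
      have : ‖z‖ ≠ 0 := by linarith
      exact_mod_cast this
    refine ⟨(‖z‖, z / ‖z‖), ⟨hz, ?_⟩, ?_⟩
    · have : ‖z‖ ≠ 0 := by linarith
      simp [this]
    · simp only
      field_simp
  · rintro ⟨⟨t, w⟩, ⟨ht, hw⟩, rfl⟩
    have ht : r < t := ht
    have hw : ‖w‖ = 1 := by simpa using hw
    simp only [mem_ofPred_eq, norm_mul, hw, mul_one, Complex.norm_real]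
    exact lt_of_lt_of_le ht (le_abs_self t)

lemma sep_bounded {K U : Set ℂ} (hU : IsOpen U) (hUb : Bornology.IsBounded U) (hK : IsClosed K)
    (hfr : frontier U ⊆ K) {x y : ℂ} (hx : x ∈ U) (hy : y ∉ U) (hyK : y ∉ K)
    (hlog : HasLog (fun z => (z - x) / (z - y)) K) : False := by
  classical
  obtain ⟨L, hL, hL1⟩ := hlog
  obtain ⟨M, hM⟩ := ContinuousMap.exists_extension (Y := ℂ) (f := ⟨K.domRestrict L, hL.domRestrict⟩)
    (e := ((↑) : K → ℂ)) hK.isClosedEmbedding_subtypeVal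
  have hM1 : ∀ z ∈ K, M z = L z := fun z hz => by
    exact congrArg (fun f : C(K, ℂ) => f ⟨z, hz⟩) hM
  let F : ℂ → ℂ := fun z => if z ∈ U then Complex.exp (M z) * (z - y) else z - x
  have hF : Continuous F := by
    refine continuous_if ?_ (Continuous.continuousOn (by fun_prop)) (Continuous.continuousOn (by fun_prop))
    intro z hz
    have hzK := hfr hz
    have : z - y ≠ 0 := fun h => hyK (by rw [← sub_eq_zero.1 h]; exact hzK)
    rw [hM1 z hzK, hL1 z hzK]
    field_simp
  have hF0 : ∀ z, F z ≠ 0 := by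
    intro z
    by_cases hz : z ∈ U
    · simp only [F, hz, if_true]
      refine mul_ne_zero (Complex.exp_ne_zero _) fun h => hy ?_
      rw [← sub_eq_zero.1 h]; exact hz
    · simp only [F, hz, if_false]
      intro h; apply hz; rw [sub_eq_zero.1 h]; exact hx
  obtain ⟨r, hr⟩ := hUb.subset_ball x
  have hr0 : 0 < r := by
    have := hr hx
    simpa using this
  refine not_hasLog_sphere (x := x) hr0 (((hasLog_univ hF hF0).mono (subset_univ _)).congr ?_)
  intro z hz
  have : z ∉ U := fun h => by
    have h1 := hr h
    rw [Metric.mem_ball] at h1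
    rw [Metric.mem_sphere] at hz
    linarith
  simp [F, this]

/-- A logarithm implies non-separation. -/
lemma joined_of_hasLog {K : Set ℂ} (hK : IsCompact K) {x y : ℂ} (hx : x ∉ K) (hy : y ∉ K)
    (hlog : HasLog (fun z => (z - x) / (z - y)) K) : y ∈ connectedComponentIn Kᶜ x := by
  by_contra hcon
  have hKc := hK.isClosed
  have hlog' : HasLog (fun z => (z - y) / (z - x)) K := hlog.inv.congr fun z _ => by simp
  have hxo : IsOpen (connectedComponentIn Kᶜ x) := hKc.isOpen_compl.connectedComponentIn
  have hyo : IsOpen (connectedComponentIn Kᶜ y) := hKc.isOpen_compl.connectedComponentIn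
  have hcon' : x ∉ connectedComponentIn Kᶜ y := fun h => by
    apply hcon; rw [← connectedComponentIn_eq h]; exact mem_connectedComponentIn hy
  obtain ⟨r, hr⟩ := hK.isBounded.subset_ball (0 : ℂ)
  set r' := max r 1
  have key : ∀ u, ¬ Bornology.IsBounded (connectedComponentIn Kᶜ u) →
      {z : ℂ | r' < ‖z‖} ⊆ connectedComponentIn Kᶜ u := by
    intro u hu
    obtain ⟨w, hw, hwr⟩ : ∃ w ∈ connectedComponentIn Kᶜ u, r' < ‖w‖ := by
      by_contra h
      push Not at h
      exact hu ((Metric.isBounded_closedBall (x := (0 : ℂ)) (r := r')).subset fun z hz => by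
        simpa using h z hz)
    rw [connectedComponentIn_eq hw]
    refine (preconn_compl_closedBall r' (by simp [r'])).subset_connectedComponentIn hwr ?_
    intro z hz hzK
    have := hr hzK
    simp at this
    have h3 : r' < ‖z‖ := hz
    have : r ≤ r' := le_max_left _ _
    linarith
  by_cases h1 : Bornology.IsBounded (connectedComponentIn Kᶜ x)
  · exact sep_bounded hxo h1 hKc (frontier_comp hKc x) (mem_connectedComponentIn hx) hcon hy hlog
  by_cases h2 : Bornology.IsBounded (connectedComponentIn Kᶜ y)
  · exact sep_bounded hyo h2 hKc (frontier_comp hKc y) (mem_connectedComponentIn hy) hcon' hx hlog'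
  have hp : ((r' + 1 : ℝ) : ℂ) ∈ {z : ℂ | r' < ‖z‖} := by
    simp only [mem_ofPred_eq, Complex.norm_real]
    exact lt_of_lt_of_le (by linarith) (le_abs_self _)
  have e1 := connectedComponentIn_eq (key x h1 hp)
  have e2 := connectedComponentIn_eq (key y h2 hp)
  apply hcon
  rw [e1, ← e2]
  exact mem_connectedComponentIn hy

/-- Janiszewski's theorem. -/
lemma janiszewski {A B S T : Set ℂ} (hA : IsCompact A) (hB : IsCompact B)
    (hAB : IsPreconnected (A ∩ B)) {x y : ℂ}
    (hS : IsPreconnected S) (hSA : S ⊆ Aᶜ) (hxS : x ∈ S) (hyS : y ∈ S)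
    (hT : IsPreconnected T) (hTB : T ⊆ Bᶜ) (hxT : x ∈ T) (hyT : y ∈ T) :
    y ∈ connectedComponentIn (A ∪ B)ᶜ x := by
  refine joined_of_hasLog (hA.union hB) ?_ ?_ ?_
  · rintro (h | h)
    exacts [hSA hxS h, hTB hxT h]
  · rintro (h | h)
    exacts [hSA hyS h, hTB hyT h]
  · exact (hasLog_of_joined hA.isClosed hS hSA hxS hyS).union
      (hasLog_of_joined hB.isClosed hT hTB hxT hyT) hA.isClosed hB.isClosed hAB

/-- Logarithms on the punctured plane. -/
lemma hasLog_punctured {f : ℂ → ℂ} {a : ℂ} {ρ : ℝ} (hρ : 0 < ρ) (hf : ContinuousOn f {a}ᶜ)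
    (h0 : ∀ z, z ≠ a → f z ≠ 0) (hs : HasLog f (Metric.sphere a ρ)) : HasLog f {a}ᶜ := by
  have hane : ∀ w : ℂ, a + Complex.exp w ∈ ({a}ᶜ : Set ℂ) := fun w => by
    simp [Complex.exp_ne_zero]
  obtain ⟨M, hM, hM1⟩ := hasLog_univ (g := fun w => f (a + Complex.exp w))
    (hf.comp_continuous (by fun_prop) hane) (fun w => h0 _ (hane w))
  have hM : Continuous M := continuousOn_univ.1 hM
  replace hM1 : ∀ w, Complex.exp (M w) = f (a + Complex.exp w) := fun w => hM1 w trivial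
  obtain ⟨L, hL, hL1⟩ := hs
  -- on the line of real part log ρ
  set S : Set ℂ := (fun t : ℝ => (Real.log ρ : ℂ) + t * Complex.I) '' univ
  have hS : IsPreconnected S := isPreconnected_univ.image _ (Continuous.continuousOn (by fun_prop))
  have hSs : ∀ w ∈ S, a + Complex.exp w ∈ Metric.sphere a ρ := by
    rintro _ ⟨t, -, rfl⟩
    simp [Complex.norm_exp, Real.exp_log hρ]
  have hper : ∀ w, Complex.exp (w + 2 * Real.pi * Complex.I) = Complex.exp w := fun w => by
    rw [Complex.exp_add, Complex.exp_two_pi_mul_I, mul_one]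
  have hc : ∀ w, M (w + 2 * Real.pi * Complex.I) = M w := by
    have h1 := const_of_exp (h := fun w => M w - L (a + Complex.exp w)) (c := 1) hS
      (hM.continuousOn.sub (hL.comp (Continuous.continuousOn (by fun_prop)) hSs)) (by
        intro w hw
        rw [Complex.exp_sub, hM1 w, hL1 _ (hSs w hw), div_self (h0 _ (hane w))])
      (x := (Real.log ρ : ℂ) + (0 : ℝ) * Complex.I)
      (y := (Real.log ρ : ℂ) + (2 * Real.pi : ℝ) * Complex.I) ⟨0, trivial, rfl⟩ ⟨_, trivial, rfl⟩
    have h2 : M (Real.log ρ + 2 * Real.pi * Complex.I) = M (Real.log ρ) := by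
      have e := hper (Real.log ρ : ℂ)
      simp only [Complex.ofReal_zero, zero_mul, add_zero, Complex.ofReal_mul,
        Complex.ofReal_ofNat] at h1
      rw [e] at h1
      linear_combination -h1
    intro w
    have h3 := const_of_exp (h := fun w => M (w + 2 * Real.pi * Complex.I) - M w) (c := 1)
      isPreconnected_univ (Continuous.continuousOn (by fun_prop)) (by
        intro w _
        rw [Complex.exp_sub, hM1 _, hM1 _, hper, div_self (h0 _ (hane w))])
      (x := w) (y := Real.log ρ) trivial trivial
    have h4 : M (w + 2 * Real.pi * Complex.I) - M w
      = M (Real.log ρ + 2 * Real.pi * Complex.I) - M (Real.log ρ) := h3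
    rw [h2, sub_self] at h4
    exact sub_eq_zero.1 h4
  have hsym : ∀ z : ℂ, z ≠ 0 → M (Complex.log (-z) + Real.pi * Complex.I) = M (Complex.log z) := by
    intro z hz
    have h1 : Complex.exp (Complex.log (-z) + Real.pi * Complex.I - Complex.log z) = 1 := by
      rw [Complex.exp_sub, Complex.exp_add, Complex.exp_log hz, Complex.exp_log (neg_ne_zero.2 hz),
        Complex.exp_pi_mul_I]
      field_simp
    obtain ⟨n, hn⟩ := Complex.exp_eq_one_iff.1 h1
    have hcn : ∀ (n : ℕ) w, M (w + n * (2 * Real.pi * Complex.I)) = M w := by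
      intro n
      induction n with
      | zero => simp
      | succ k ih =>
        intro w
        have : w + ((k + 1 : ℕ) : ℂ) * (2 * Real.pi * Complex.I)
          = (w + k * (2 * Real.pi * Complex.I)) + 2 * Real.pi * Complex.I := by push_cast; ring
        rw [this, hc, ih]
    have e : Complex.log (-z) + Real.pi * Complex.I
      = Complex.log z + n * (2 * Real.pi * Complex.I) := by linear_combination hn
    obtain ⟨m, rfl | rfl⟩ := n.eq_nat_or_neg
    · rw [e]; simpa using hcn m (Complex.log z)
    · have := hcn m (Complex.log (-z) + Real.pi * Complex.I)
      rw [← this]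
      congr 1
      push_cast at e
      linear_combination e
  refine ⟨fun z => M (Complex.log (z - a)), ?_, ?_⟩
  · intro z hz
    have hz : z - a ≠ 0 := sub_ne_zero.2 hz
    by_cases hsl : z - a ∈ Complex.slitPlane
    · exact ((hM.continuousAt).comp ((continuousAt_id.sub continuousAt_const).clog hsl)).continuousWithinAt
    · have hsl' : -(z - a) ∈ Complex.slitPlane := by
        rw [Complex.mem_slitPlane_iff] at hsl ⊢
        push Not at hsl
        left
        rcases lt_or_eq_of_le hsl.1 with h | h
        · simpa using h
        · exact (hz (Complex.ext h hsl.2)).elim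
      have h1 : ContinuousAt (fun z => M (Complex.log (-(z - a)) + Real.pi * Complex.I)) z :=
        (hM.continuousAt).comp
          (((continuousAt_id.sub continuousAt_const).neg.clog hsl').add continuousAt_const)
      refine h1.continuousWithinAt.congr (fun w hw => ?_) ?_
      · exact (hsym _ (sub_ne_zero.2 hw)).symm
      · exact (hsym _ hz).symm
  · intro z hz
    have hz' : z - a ≠ 0 := sub_ne_zero.2 hz
    rw [hM1 _, Complex.exp_log hz']
    congr 1; ring


/-- The standing situation, in the complex plane. -/
structure Setup (E R : Set ℂ) : Prop where
  cpt : IsCompact E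
  conn : IsPreconnected E
  lc : ∀ z ∈ E, ∀ r > 0, ∃ W ⊆ E ∩ Metric.ball z r, IsPreconnected W ∧ z ∈ W ∧ W ∈ 𝓝[E] z
  nontriv : E.Nontrivial
  nosep : ∀ p, IsPreconnected (E \ {p})
  Ropen : IsOpen R
  Rconn : IsPreconnected R
  Rne : R.Nonempty
  Rdisj : R ⊆ Eᶜ
  Rfr : frontier R ⊆ E

namespace Setup
variable {E R : Set ℂ}

lemma maximal (h : Setup E R) {S : Set ℂ} (hS : IsPreconnected S) (hSE : S ⊆ Eᶜ) {x : ℂ}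
    (hx : x ∈ S) (hxR : x ∈ R) : S ⊆ R := by
  intro y hy
  by_contra hyR
  obtain ⟨z, hz, hz'⟩ := frontier_inter hS hx hy hxR hyR
  exact hSE hz (h.Rfr hz')

lemma exists_ne (h : Setup E R) (a : ℂ) : ∃ q ∈ E, q ≠ a := h.nontriv.exists_ne a

lemma compl_preconn (h : Setup E R) (a : ℂ) (ha : a ∈ E) : IsPreconnected (Rᶜ \ {a}) := by
  obtain ⟨q, hq, hqa⟩ := h.exists_ne a
  have hEc := h.cpt.isClosed
  refine isPreconnected_of_forall q fun z hz => ?_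
  have hE : E \ {a} ⊆ Rᶜ \ {a} := fun w hw => ⟨fun hR => h.Rdisj hR hw.1, hw.2⟩
  by_cases hzE : z ∈ E
  · exact ⟨E \ {a}, hE, ⟨hq, hqa⟩, ⟨hzE, hz.2⟩, h.nosep a⟩
  · set W := connectedComponentIn Eᶜ z
    have hzW : z ∈ W := mem_connectedComponentIn hzE
    have hWE : W ⊆ Eᶜ := connectedComponentIn_subset _ _
    obtain ⟨e, he, he'⟩ := frontier_inter (O := W)
      (isConnected_compl_singleton_of_one_lt_rank one_lt_rank_C a).isPreconnected
      hz.2 hqa hzW (fun hh => hWE hh hq)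
    have heE : e ∈ E := frontier_comp hEc z he'
    have hW : IsPreconnected W := isPreconnected_connectedComponentIn
    have hT : IsPreconnected (insert e W) := hW.subset_closure (subset_insert _ _)
      (insert_subset (frontier_subset_closure he') subset_closure)
    refine ⟨(E \ {a}) ∪ insert e W, ?_, Or.inl ⟨hq, hqa⟩, Or.inr (Or.inr hzW),
      IsPreconnected.union e ⟨heE, he⟩ (mem_insert _ _) (h.nosep a) hT⟩
    refine union_subset hE (insert_subset (hE ⟨heE, he⟩) fun w hw => ⟨fun hwR => ?_, ?_⟩)
    · exact hz.1 (h.maximal hW hWE hw hwR hzW)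
    · rintro rfl
      exact hWE hw ha

lemma mem_frontier (h : Setup E R) {z : ℂ} (h1 : z ∈ closure R) (h2 : z ∉ R) : z ∈ frontier R := by
  rw [h.Ropen.frontier_eq]; exact ⟨h1, h2⟩

/-- No point of the frontier cuts the frontier. -/
lemma frontier_preconn (h : Setup E R) (a : ℂ) (ha : a ∈ E) : IsPreconnected (frontier R \ {a}) := by
  classical
  rw [isPreconnected_closed_iff]
  intro P Q hP hQ hcov hPne hQne
  by_contra hne
  set P' := frontier R ∩ P
  set Q' := frontier R ∩ Q
  have cP : IsClosed P' := isClosed_frontier.inter hP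
  have cQ : IsClosed Q' := isClosed_frontier.inter hQ
  obtain ⟨p, ⟨hpF, hpa⟩, hpP⟩ := hPne
  obtain ⟨q, ⟨hqF, hqa⟩, hqQ⟩ := hQne
  have neP : P'.Nonempty := ⟨p, hpF, hpP⟩
  have neQ : Q'.Nonempty := ⟨q, hqF, hqQ⟩
  have hdis : ∀ z, z ∈ P' → z ∈ Q' → z = a := by
    intro z hz1 hz2
    by_contra hza
    exact hne ⟨z, ⟨hz1.1, hza⟩, hz1.2, hz2.2⟩
  let u : ℂ → ℝ := fun z => Metric.infDist z P' / (Metric.infDist z P' + Metric.infDist z Q')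
  have hden : ∀ z, z ≠ a → Metric.infDist z P' + Metric.infDist z Q' ≠ 0 := by
    intro z hza h0
    have h1 := Metric.infDist_nonneg (x := z) (s := P')
    have h2 := Metric.infDist_nonneg (x := z) (s := Q')
    exact hza (hdis z ((cP.mem_iff_infDist_zero neP).2 (by linarith))
      ((cQ.mem_iff_infDist_zero neQ).2 (by linarith)))
  have hu : ContinuousOn u {a}ᶜ :=
    (Metric.continuous_infDist_pt _).continuousOn.div
      ((Metric.continuous_infDist_pt _).add (Metric.continuous_infDist_pt _)).continuousOn hden
  have huP : ∀ z ∈ P', u z = 0 := fun z hz => by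
    simp [u, (cP.mem_iff_infDist_zero neP).1 hz]
  have huQ : ∀ z ∈ Q', z ≠ a → u z = 1 := fun z hz hza => by
    have h0 := hden z hza
    have h1 := (cQ.mem_iff_infDist_zero neQ).1 hz
    simp only [u]
    rw [h1, add_zero] at h0 ⊢
    exact div_self h0
  let v : ℂ → ℂ := fun z => 2 * Real.pi * Complex.I * u z
  have hv : ContinuousOn v {a}ᶜ :=
    continuousOn_const.mul (Complex.continuous_ofReal.comp_continuousOn hu)
  have hvF : ∀ z ∈ frontier R, z ≠ a → Complex.exp (v z) = 1 := by
    intro z hz hza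
    rcases hcov ⟨hz, hza⟩ with hzP | hzQ
    · simp [v, huP z ⟨hz, hzP⟩]
    · simp [v, huQ z ⟨hz, hzQ⟩ hza, Complex.exp_two_pi_mul_I]
  let f : ℂ → ℂ := fun z => if z ∈ closure R then Complex.exp (v z) else 1
  have hfY : ∀ z ∈ Rᶜ \ {a}, f z = 1 := by
    intro z hz
    by_cases hzc : z ∈ closure R
    · simp only [f, hzc, if_true]
      exact hvF z (h.mem_frontier hzc hz.1) hz.2
    · simp [f, hzc]
  have hfR : ∀ z ∈ closure R, f z = Complex.exp (v z) := fun z hz => by simp [f, hz]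
  have hf : ContinuousOn f {a}ᶜ := by
    refine ContinuousOn.if ?_ ?_ ?_
    · rintro z ⟨hza, hz⟩
      have hz' : z ∈ frontier R := by
        have := frontier_closure_subset hz
        exact this
      exact hvF z hz' hza
    · exact (hv.mono inter_subset_left).cexp
    · exact continuousOn_const
  have hf0 : ∀ z, z ≠ a → f z ≠ 0 := by
    intro z _
    by_cases hzc : z ∈ closure R
    · rw [hfR z hzc]; exact Complex.exp_ne_zero _
    · simp [f, hzc]
  obtain ⟨ρ, hρ⟩ := h.cpt.isBounded.subset_ball a
  have hρ0 : 0 < ρ := by simpa using hρ ha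
  have hsE : Metric.sphere a ρ ⊆ Eᶜ := fun z hz hzE => by
    have h1 := hρ hzE
    rw [Metric.mem_ball] at h1
    rw [Metric.mem_sphere] at hz
    linarith
  have hsa : Metric.sphere a ρ ⊆ {a}ᶜ := fun z hz hza => by
    rw [mem_singleton_iff] at hza
    rw [hza] at hz
    simp at hz
    linarith
  have hsph : HasLog f (Metric.sphere a ρ) := by
    by_cases hx : ∃ x ∈ Metric.sphere a ρ, x ∈ R
    · obtain ⟨x, hx, hxR⟩ := hx
      have hsR := h.maximal (isPreconnected_sphere one_lt_rank_C a ρ) hsE hx hxR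
      exact ⟨v, hv.mono hsa, fun z hz => (hfR z (subset_closure (hsR hz))).symm⟩
    · push Not at hx
      exact ⟨fun _ => 0, continuousOn_const, fun z hz => by
        rw [hfY z ⟨hx z hz, hsa hz⟩, Complex.exp_zero]⟩
  obtain ⟨L, hL, hL1⟩ := hasLog_punctured hρ0 hf hf0 hsph
  have e1 : L p = L q := const_of_exp (c := 1) (h.compl_preconn a ha) (hL.mono fun z hz => hz.2)
    (fun z hz => by rw [hL1 z hz.2, hfY z hz])
    ⟨fun hR => h.Rdisj hR (h.Rfr hpF), hpa⟩ ⟨fun hR => h.Rdisj hR (h.Rfr hqF), hqa⟩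
  have hcl : IsPreconnected (closure R \ {a}) := h.Rconn.subset_closure
    (fun z hz => ⟨subset_closure hz, fun hza => h.Rdisj hz (by rw [mem_singleton_iff.1 hza]; exact ha)⟩)
    (fun z hz => hz.1)
  have e2 : L p - v p = L q - v q := const_of_exp (h := fun z => L z - v z) (c := 1) hcl
    ((hL.mono fun z hz => hz.2).sub (hv.mono fun z hz => hz.2))
    (fun z hz => by
      rw [Complex.exp_sub, hL1 z hz.2, hfR z hz.1, div_self (Complex.exp_ne_zero _)])
    ⟨frontier_subset_closure hpF, hpa⟩ ⟨frontier_subset_closure hqF, hqa⟩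
  have e3 : v p = 0 := by simp [v, huP p ⟨hpF, hpP⟩]
  have e4 : v q = 2 * Real.pi * Complex.I := by simp [v, huQ q ⟨hqF, hqQ⟩ hqa]
  rw [e1, e3, e4] at e2
  have : 2 * (Real.pi : ℂ) * Complex.I = 0 := by linear_combination e2
  exact Complex.two_pi_I_ne_zero this

lemma frontier_nontrivial (h : Setup E R) : (frontier R).Nontrivial := by
  obtain ⟨x, hx⟩ := h.Rne
  obtain ⟨q, hq⟩ := h.nontriv.nonempty
  obtain ⟨c, -, hc⟩ := frontier_inter isPreconnected_univ (mem_univ x) (mem_univ q) hx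
    (fun hR => h.Rdisj hR hq)
  obtain ⟨q', hq', hne⟩ := h.exists_ne c
  obtain ⟨c', hc'1, hc'⟩ := frontier_inter
    (isConnected_compl_singleton_of_one_lt_rank one_lt_rank_C c).isPreconnected (x := x) (y := q')
    (fun hxc => h.Rdisj hx (by rw [mem_singleton_iff.1 hxc]; exact h.Rfr hc)) hne hx
    (fun hR => h.Rdisj hR hq')
  exact ⟨c', hc', c, hc, hc'1⟩

lemma link (h : Setup E R) (a : ℂ) {z w : ℂ} (hz : z ∈ E \ {a}) (hw : w ∈ E \ {a}) :
    ∃ K ⊆ E \ {a}, IsCompact K ∧ IsPreconnected K ∧ z ∈ K ∧ w ∈ K := by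
  refine (h.nosep a).induction₂
    (fun z w => ∃ K ⊆ E \ {a}, IsCompact K ∧ IsPreconnected K ∧ z ∈ K ∧ w ∈ K) ?_ ?_ ?_ hz hw
  · rintro z ⟨hz, hza⟩
    have hd : 0 < dist z a := dist_pos.2 hza
    obtain ⟨W, hWE, hW, hzW, hWn⟩ := h.lc z hz (dist z a / 2) (by positivity)
    have hcl : closure W ⊆ E \ {a} := by
      intro w' hw
      refine ⟨closure_minimal (fun x hx => (hWE hx).1) h.cpt.isClosed hw, ?_⟩
      rintro rfl
      have : w' ∈ Metric.closedBall z (dist z w' / 2) :=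
        closure_minimal (fun x hx => Metric.ball_subset_closedBall (hWE hx).2)
          Metric.isClosed_closedBall (by assumption)
      rw [Metric.mem_closedBall, dist_comm] at this
      linarith
    have : W ∈ 𝓝[E \ {a}] z := nhdsWithin_mono _ sdiff_subset hWn
    filter_upwards [this] with w hw
    exact ⟨closure W, hcl, h.cpt.of_isClosed_subset isClosed_closure (hcl.trans sdiff_subset),
      hW.closure, subset_closure hzW, subset_closure hw⟩
  · rintro x y z - - - ⟨K, h1, h2, h3, h4, h5⟩ ⟨K', h1', h2', h3', h4', h5'⟩
    exact ⟨K ∪ K', union_subset h1 h1', h2.union h2', h3.union y h5 h4' h3', Or.inl h4, Or.inr h5'⟩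
  · rintro x y - - ⟨K, h1, h2, h3, h4, h5⟩
    exact ⟨K, h1, h2, h3, h5, h4⟩

lemma bigK (h : Setup E R) (a : ℂ) {ε : ℝ} (hε : 0 < ε) :
    ∃ K ⊆ E \ {a}, IsCompact K ∧ IsPreconnected K ∧ E \ Metric.ball a ε ⊆ K := by
  obtain ⟨q, hq, hqa⟩ := h.exists_ne a
  have hc : IsCompact (E \ Metric.ball a ε) := h.cpt.diff Metric.isOpen_ball
  suffices hh : ∃ K ⊆ E \ {a}, IsCompact K ∧ IsPreconnected K ∧ q ∈ K ∧ E \ Metric.ball a ε ⊆ K by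
    obtain ⟨K, h1, h2, h3, h4, h5⟩ := hh
    exact ⟨K, h1, h2, h3, h5⟩
  refine hc.induction_on
    (p := fun S => ∃ K ⊆ E \ {a}, IsCompact K ∧ IsPreconnected K ∧ q ∈ K ∧ S ⊆ K) ?_ ?_ ?_ ?_
  · exact ⟨{q}, by simp [hq, hqa], isCompact_singleton, isPreconnected_singleton, rfl, by simp⟩
  · rintro S T hST ⟨K, h1, h2, h3, h4, h5⟩
    exact ⟨K, h1, h2, h3, h4, hST.trans h5⟩
  · rintro S T ⟨K, h1, h2, h3, h4, h5⟩ ⟨K', h1', h2', h3', h4', h5'⟩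
    exact ⟨K ∪ K', union_subset h1 h1', h2.union h2', h3.union q h4 h4' h3', Or.inl h4,
      union_subset_union h5 h5'⟩
  · rintro z ⟨hzE, hzb⟩
    have hza : z ≠ a := by rintro rfl; exact hzb (Metric.mem_ball_self hε)
    have hd : 0 < dist z a := dist_pos.2 hza
    obtain ⟨W, hWE, hW, hzW, hWn⟩ := h.lc z hzE (dist z a / 2) (by positivity)
    have hcl : closure W ⊆ E \ {a} := by
      intro w hw
      refine ⟨closure_minimal (fun x hx => (hWE hx).1) h.cpt.isClosed hw, ?_⟩
      rintro rfl
      have : w ∈ Metric.closedBall z (dist z w / 2) :=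
        closure_minimal (fun x hx => Metric.ball_subset_closedBall (hWE hx).2)
          Metric.isClosed_closedBall hw
      rw [Metric.mem_closedBall, dist_comm] at this
      linarith
    obtain ⟨K, h1, h2, h3, h4, h5⟩ := h.link a ⟨hq, hqa⟩ ⟨hzE, hza⟩
    refine ⟨W, nhdsWithin_mono _ sdiff_subset hWn, K ∪ closure W, union_subset h1 hcl,
      h2.union (h.cpt.of_isClosed_subset isClosed_closure (hcl.trans sdiff_subset)),
      h3.union z h5 (subset_closure hzW) hW.closure, Or.inl h4,
      subset_closure.trans subset_union_right⟩

/-- uniform local connectedness of `R` at the points of `E`. -/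
lemma ulc (h : Setup E R) {a : ℂ} {ε : ℝ} (hε : 0 < ε) :
    ∃ δ > 0, ∀ x ∈ R, ∀ y ∈ R, dist x a < δ → dist y a < δ → JoinedIn (R ∩ Metric.ball a ε) x y := by
  obtain ⟨K, hKE, hKc, hKp, hK⟩ := h.bigK a hε
  obtain ⟨δ, hδ, hball⟩ := Metric.isOpen_iff.1 hKc.isClosed.isOpen_compl a (fun haK => (hKE haK).2 rfl)
  refine ⟨min δ ε, lt_min hδ hε, fun x hx y hy hxa hya => ?_⟩
  have hB : IsCompact (Metric.sphere a ε ∪ K) := (isCompact_sphere a ε).union hKc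
  have hint : E ∩ (Metric.sphere a ε ∪ K) = K := by
    apply Subset.antisymm
    · rintro z ⟨hzE, hz | hz⟩
      · refine hK ⟨hzE, fun hzb => ?_⟩
        rw [Metric.mem_ball] at hzb
        rw [Metric.mem_sphere] at hz
        linarith
      · exact hz
    · exact fun z hz => ⟨(hKE hz).1, Or.inr hz⟩
  have hconn : IsPreconnected (E ∩ (Metric.sphere a ε ∪ K)) := by rw [hint]; exact hKp
  have hbp : IsPreconnected (Metric.ball a (min δ ε)) := (convex_ball a _).isPreconnected
  have hbs : Metric.ball a (min δ ε) ⊆ (Metric.sphere a ε ∪ K)ᶜ := by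
    rintro z hz (hzs | hzK)
    · rw [Metric.mem_ball] at hz
      rw [Metric.mem_sphere] at hzs
      have := min_le_right δ ε
      linarith
    · exact hball (Metric.ball_subset_ball (min_le_left _ _) hz) hzK
  have hy' := janiszewski h.cpt hB hconn h.Rconn h.Rdisj hx hy hbp hbs hxa hya
  set S := connectedComponentIn (E ∪ (Metric.sphere a ε ∪ K))ᶜ x
  have hSsub : S ⊆ (E ∪ (Metric.sphere a ε ∪ K))ᶜ := connectedComponentIn_subset _ _
  have hxS : x ∈ S := mem_connectedComponentIn (by
    rintro (hh | hh)
    · exact h.Rdisj hx hh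
    · exact hbs hxa hh)
  have hSo : IsOpen S := ((h.cpt.union hB).isClosed.isOpen_compl).connectedComponentIn
  have hSp : IsPreconnected S := isPreconnected_connectedComponentIn
  have hSR : S ⊆ R := h.maximal hSp (fun z hz hzE => hSsub hz (Or.inl hzE)) hxS hx
  have hSb : S ⊆ Metric.ball a ε := by
    intro z hz
    by_contra hzb
    obtain ⟨w, hw, hw'⟩ := frontier_inter (O := Metric.ball a ε) hSp hxS hz
      (lt_of_lt_of_le hxa (min_le_right _ _)) hzb
    exact hSsub hw (Or.inr (Or.inl (Metric.frontier_ball_subset_sphere hw')))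
  have hSpath : IsPathConnected S := hSo.isConnected_iff_isPathConnected.1 ⟨⟨x, hxS⟩, hSp⟩
  exact (hSpath.joinedIn x hxS y hy').mono (subset_inter hSR hSb)

end Setup


/-- infinite concatenation of paths -/
lemma exists_ray {S : ℕ → Set ℂ} {x : ℕ → ℂ} (hx : ∀ n, JoinedIn (S n) (x n) (x (n + 1))) :
    ∃ γ : ℝ → ℂ, Continuous γ ∧ ∀ t, γ t ∈ S ⌊t⌋₊ := by
  choose P hP using hx
  let γ : ℝ → ℂ := fun t => (P ⌊t⌋₊).extend (t - ⌊t⌋₊)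
  have hmem : ∀ n t, (P n).extend t ∈ S n := by
    intro n t
    have : (P n).extend t ∈ range (P n) := by
      rw [← Path.extend_range]; exact mem_range_self t
    obtain ⟨u, hu⟩ := this
    rw [← hu]; exact hP n u
  refine ⟨γ, ?_, fun t => hmem _ _⟩
  let F : ℕ → Set ℝ := fun n => if n = 0 then Iic 1 else Icc (n : ℝ) (n + 1)
  have hF : ∀ n t, t ∈ F n → t ≤ n + 1 ∧ (n ≠ 0 → (n : ℝ) ≤ t) := by
    intro n t ht
    by_cases hn : n = 0
    · subst hn
      simp only [F, if_true] at ht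
      simpa using ht
    · simp only [F, hn, if_false] at ht
      exact ⟨ht.2, fun _ => ht.1⟩
  have hlf : LocallyFinite F := by
    intro t
    refine ⟨Iio (t + 1), Iio_mem_nhds (by linarith), ?_⟩
    refine (finite_Iic ⌈t + 1⌉₊).subset ?_
    rintro n ⟨s, hs, hst⟩
    have hst : s < t + 1 := hst
    by_cases hn : n = 0
    · simp [hn]
    · have h1 := (hF n s hs).2 hn
      have : (n : ℝ) ≤ ⌈t + 1⌉₊ := by
        have := Nat.le_ceil (t + 1)
        linarith
      exact_mod_cast this
  refine hlf.continuous ?_ ?_ ?_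
  · rw [eq_univ_iff_forall]
    intro t
    rw [mem_iUnion]
    refine ⟨⌊t⌋₊, ?_⟩
    by_cases hn : ⌊t⌋₊ = 0
    · rw [hn]
      simp only [F, if_true]
      have := Nat.lt_floor_add_one t
      rw [hn] at this
      simp at this
      exact this.le
    · simp only [F, hn, if_false]
      refine ⟨Nat.floor_le ?_, (Nat.lt_floor_add_one t).le⟩
      by_contra h
      exact hn (Nat.floor_of_nonpos (by linarith))
  · intro n
    by_cases hn : n = 0
    · simp only [F, hn, if_true]; exact isClosed_Iic
    · simp only [F, hn, if_false]; exact isClosed_Icc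
  · intro n
    have : Continuous fun t : ℝ => (P n).extend (t - n) :=
      (P n).continuous_extend.comp (continuous_id.sub continuous_const)
    refine this.continuousOn.congr fun t ht => ?_
    obtain ⟨h1, h2⟩ := hF n t ht
    have hγn : ∀ m, ⌊t⌋₊ = m → γ t = (P m).extend (t - m) := by rintro m rfl; rfl
    rcases h1.lt_or_eq with h1 | h1
    · have : ⌊t⌋₊ = n := by
        by_cases hn : n = 0
        · subst hn
          rw [Nat.floor_eq_zero]
          simpa using h1
        · exact (Nat.floor_eq_iff' hn).2 ⟨h2 hn, h1⟩
      exact hγn _ this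
    · have : ⌊t⌋₊ = n + 1 := by
        rw [h1]; exact_mod_cast Nat.floor_natCast (n + 1)
      rw [hγn _ this]
      have e1 : t - (n : ℝ) = 1 := by linarith
      have e2 : t - ((n + 1 : ℕ) : ℝ) = 0 := by push_cast; linarith
      show _ = (P n).extend (t - n)
      rw [e1, e2]
      simp

lemma first_hit {h : ℝ → ℝ} (hc : Continuous h) {s0 s1 r : ℝ} (h01 : s0 ≤ s1) (h0 : r < h s0)
    (h1 : h s1 ≤ r) : ∃ s2 ∈ Icc s0 s1, h s2 = r ∧ ∀ s ∈ Icc s0 s2, r ≤ h s := by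
  have hcpt : IsCompact (Icc s0 s1 ∩ {s | h s ≤ r}) :=
    isCompact_Icc.inter_right (isClosed_le hc continuous_const)
  obtain ⟨s2, ⟨hs2, hs2r⟩, hmin⟩ := hcpt.exists_isLeast ⟨s1, ⟨h01, le_rfl⟩, h1⟩
  have hs2r : h s2 ≤ r := hs2r
  have hlt : ∀ s ∈ Icc s0 s1, s < s2 → r < h s := by
    intro s hs hss
    by_contra hle
    exact absurd (hmin ⟨hs, not_lt.1 hle⟩) (not_le.2 hss)
  have heq : h s2 = r := by
    obtain ⟨s, hs, hsr⟩ := intermediate_value_Icc' hs2.1 hc.continuousOn ⟨hs2r, h0.le⟩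
    rcases hs.2.lt_or_eq with hlt' | rfl
    · have := hlt s ⟨hs.1, hs.2.trans hs2.2⟩ hlt'
      linarith
    · exact hsr
  refine ⟨s2, hs2, heq, fun s hs => ?_⟩
  rcases hs.2.lt_or_eq with h' | rfl
  · exact (hlt s ⟨hs.1, hs.2.trans hs2.2⟩ h').le
  · exact heq.ge

namespace Setup
variable {E R : Set ℂ}

/-- Points of the frontier are accessible. -/
lemma access (h : Setup E R) {a : ℂ} (ha : a ∈ frontier R) :
    ∃ β : ℝ → ℂ, Continuous β ∧ β 0 = a ∧ ∀ t > 0, β t ∈ R := by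
  have hd : ∀ n : ℕ, ∃ δ > 0, ∀ x ∈ R, ∀ y ∈ R, dist x a < δ → dist y a < δ →
      JoinedIn (R ∩ Metric.ball a (1 / ((n : ℝ) + 1))) x y := fun n => h.ulc (by positivity)
  choose δ hδ hj using hd
  have hx : ∀ n : ℕ, ∃ x ∈ R, dist x a < min (δ n) (δ (n - 1)) := by
    intro n
    obtain ⟨x, hx, hxa⟩ := Metric.mem_closure_iff.1 (frontier_subset_closure ha) _
      (lt_min (hδ n) (hδ (n - 1)))
    exact ⟨x, hx, by rwa [dist_comm]⟩
  choose x hxR hxa using hx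
  obtain ⟨γ, hγ, hγS⟩ := exists_ray (x := x)
    (S := fun n => R ∩ Metric.ball a (1 / ((n : ℝ) + 1))) (fun n => hj n _ (hxR n) _ (hxR (n + 1))
      ((hxa n).trans_le (min_le_left _ _)) ((hxa (n + 1)).trans_le (min_le_right _ _)))
  have hlim : Tendsto γ atTop (𝓝 a) := by
    rw [tendsto_iff_dist_tendsto_zero]
    refine squeeze_zero (fun _ => dist_nonneg) (fun t => (hγS t).2.le) ?_
    exact tendsto_one_div_add_atTop_nhds_zero_nat.comp tendsto_nat_floor_atTop
  refine ⟨fun t => if t ≤ 0 then a else γ (1 / t), ?_, by simp, fun t ht => ?_⟩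
  · rw [continuous_iff_continuousAt]
    intro t
    rcases lt_trichotomy t 0 with ht | rfl | ht
    · refine continuousAt_const.congr (f := fun _ => a) ?_
      filter_upwards [Iio_mem_nhds ht] with s hs
      have hs : s < 0 := hs
      simp [hs.le]
    · rw [ContinuousAt, ← nhdsLE_sup_nhdsGT, tendsto_sup]
      simp only [le_refl, if_true]
      constructor
      · refine tendsto_const_nhds.congr' ?_
        filter_upwards [self_mem_nhdsWithin] with s hs
        have hs : s ≤ 0 := hs
        simp [hs]
      · have h1 : Tendsto (fun t : ℝ => γ (1 / t)) (𝓝[>] 0) (𝓝 a) := by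
          simp only [one_div]
          exact hlim.comp tendsto_inv_nhdsGT_zero
        refine h1.congr' ?_
        filter_upwards [self_mem_nhdsWithin] with s hs
        have hs : 0 < s := hs
        simp [not_le.2 hs]
    · have h1 : ContinuousAt (fun t : ℝ => γ (1 / t)) t :=
        hγ.continuousAt.comp (continuousAt_const.div continuousAt_id ht.ne')
      refine h1.congr ?_
      filter_upwards [Ioi_mem_nhds ht] with s hs
      have hs : 0 < s := hs
      simp [not_le.2 hs]
  · simp only [not_le.2 ht, if_false]
    exact (hγS _).1

lemma arc (h : Setup E R) {a b : ℂ} (ha : a ∈ frontier R) (hb : b ∈ frontier R) :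
    ∃ β : ℝ → ℂ, Continuous β ∧ β 0 = a ∧ β 3 = b ∧ ∀ t, 0 < t → t < 3 → β t ∈ R := by
  obtain ⟨f, hf, hf0, hfR⟩ := h.access ha
  obtain ⟨g, hg, hg0, hgR⟩ := h.access hb
  have hpc : IsPathConnected R := h.Ropen.isConnected_iff_isPathConnected.1 ⟨h.Rne, h.Rconn⟩
  obtain ⟨P, hP⟩ := hpc.joinedIn (f 1) (hfR 1 one_pos) (g 1) (hgR 1 one_pos)
  have hmem : ∀ t, P.extend t ∈ R := by
    intro t
    have : P.extend t ∈ range P := by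
      rw [← Path.extend_range]; exact mem_range_self t
    obtain ⟨u, hu⟩ := this
    rw [← hu]; exact hP u
  refine ⟨fun t => if t ≤ 1 then f t else if t ≤ 2 then P.extend (t - 1) else g (3 - t),
    ?_, by simp [hf0], by norm_num [hg0], ?_⟩
  · refine Continuous.if_le hf ?_ continuous_id continuous_const ?_
    · refine Continuous.if_le (P.continuous_extend.comp (by fun_prop)) (hg.comp (by fun_prop))
        continuous_id continuous_const ?_
      rintro t rfl
      norm_num
    · rintro t rfl
      norm_num
  · intro t h0 h3
    simp only
    split_ifs
    · exact hfR t h0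
    · exact hmem _
    · exact hgR _ (by linarith)

lemma crosscut (h : Setup E R) {a b : ℂ} (ha : a ∈ frontier R) (hb : b ∈ frontier R) (hab : a ≠ b) :
    ∃ (p : ℂ) (r : ℝ) (A B : Set ℂ) (α α' : ℂ), 0 < r ∧ Metric.closedBall p r ⊆ R ∧
      IsCompact A ∧ IsCompact B ∧ IsPreconnected A ∧ IsPreconnected B ∧ Disjoint A B ∧
      a ∈ A ∧ b ∈ B ∧ A ⊆ insert a R ∧ B ⊆ insert b R ∧
      (∀ z ∈ A, r ≤ dist z p) ∧ (∀ z ∈ B, r ≤ dist z p) ∧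
      α ∈ A ∧ α' ∈ B ∧ dist α p = r ∧ dist α' p = r := by
  obtain ⟨β, hβ, hβ0, hβ3, hβR⟩ := h.arc ha hb
  have haR : a ∉ R := fun hh => h.Rdisj hh (h.Rfr ha)
  have hbR : b ∉ R := fun hh => h.Rdisj hh (h.Rfr hb)
  have c1 : IsCompact (β '' Icc 0 1) := isCompact_Icc.image hβ
  have c2 : IsCompact (Icc 0 3 ∩ β ⁻¹' (β '' Icc 0 1)) :=
    isCompact_Icc.inter_right (c1.isClosed.preimage hβ)
  obtain ⟨t1, ⟨ht1, s1, hs1, hst⟩, hmax⟩ := c2.exists_isGreatest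
    ⟨1, by norm_num, ⟨1, by norm_num, rfl⟩⟩
  have ht1' : 1 ≤ t1 := hmax ⟨by norm_num, ⟨1, by norm_num, rfl⟩⟩
  have ht13 : t1 < 3 := by
    rcases ht1.2.lt_or_eq with hh | rfl
    · exact hh
    · exfalso
      rw [hβ3] at hst
      rcases hs1.1.lt_or_eq with h0 | rfl
      · exact hbR (hst ▸ hβR s1 h0 (by linarith [hs1.2]))
      · exact hab (hβ0.symm.trans hst)
  set p := β t1 with hp
  have hpR : p ∈ R := hβR t1 (by linarith) ht13
  obtain ⟨r, hr, hball⟩ := Metric.nhds_basis_closedBall.mem_iff.1 (h.Ropen.mem_nhds hpR)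
  have hout : ∀ z, z ∉ R → r < dist z p := by
    intro z hz
    by_contra hle
    exact hz (hball (not_lt.1 hle))
  obtain ⟨s2, hs2, hs2r, hs2o⟩ := first_hit (h := fun s => dist (β s) p) (by fun_prop) hs1.1
    (by simp only [hβ0]; exact hout a haR) (r := r) (by simp only [hst, dist_self]; exact hr.le)
  obtain ⟨t2, ht2, ht2r, ht2o⟩ := first_hit (h := fun s => dist (β (3 - s)) p) (by fun_prop)
    (s0 := 0) (s1 := 3 - t1) (r := r) (by linarith)
    (by simp only [sub_zero, hβ3]; exact hout b hbR)
    (by simp only [sub_sub_cancel, ← hp, dist_self]; exact hr.le)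
  refine ⟨p, r, β '' Icc 0 s2, β '' Icc (3 - t2) 3, β s2, β (3 - t2), hr, hball,
    isCompact_Icc.image hβ, isCompact_Icc.image hβ, isPreconnected_Icc.image _ hβ.continuousOn,
    isPreconnected_Icc.image _ hβ.continuousOn, ?_, ⟨0, ⟨le_rfl, hs2.1⟩, hβ0⟩,
    ⟨3, ⟨by linarith [ht2.1], le_rfl⟩, hβ3⟩, ?_, ?_, ?_, ?_,
    ⟨s2, ⟨hs2.1, le_rfl⟩, rfl⟩, ⟨3 - t2, ⟨le_rfl, by linarith [ht2.1]⟩, rfl⟩, hs2r, ht2r⟩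
  · rw [Set.disjoint_left]
    rintro _ ⟨s, hs, rfl⟩ ⟨t, ht, hts⟩
    have htt : t ≤ t1 := hmax ⟨⟨by linarith [ht2.2, ht.1], ht.2⟩,
      ⟨s, ⟨hs.1, hs.2.trans (hs2.2.trans hs1.2)⟩, hts.symm⟩⟩
    have : t = t1 := le_antisymm htt (by linarith [ht2.2, ht.1])
    have h2 := hs2o s hs
    rw [← hts, this] at h2
    simp [← hp] at h2
    linarith
  · rintro _ ⟨s, hs, rfl⟩
    rcases hs.1.lt_or_eq with h0 | rfl
    · exact Or.inr (hβR s h0 (by linarith [hs.2, hs2.2, hs1.2]))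
    · exact Or.inl hβ0
  · rintro _ ⟨s, hs, rfl⟩
    rcases hs.2.lt_or_eq with h0 | rfl
    · exact Or.inr (hβR s (by linarith [hs.1, ht2.2]) h0)
    · exact Or.inl hβ3
  · rintro _ ⟨s, hs, rfl⟩
    exact hs2o s hs
  · rintro _ ⟨s, hs, rfl⟩
    have := ht2o (3 - s) ⟨by linarith [hs.2], by linarith [hs.1]⟩
    simpa using this

end Setup


lemma mob_slit {s v z : ℂ} {η : ℝ} (hz : ∀ u ∈ Icc (-1 : ℝ) 1, z ≠ s + u * (Complex.I * η * v)) :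
    (z - (s + Complex.I * η * v)) / (z - (s - Complex.I * η * v)) ∈ Complex.slitPlane := by
  have h1 : z - (s - Complex.I * η * v) ≠ 0 := by
    intro h
    refine hz (-1) (by norm_num) ?_
    push_cast
    linear_combination h
  rw [Complex.mem_slitPlane_iff_not_le_zero]
  intro hle
  rw [Complex.le_def] at hle
  set q := (z - (s + Complex.I * η * v)) / (z - (s - Complex.I * η * v)) with hq
  obtain ⟨t, ht, hqt⟩ : ∃ t : ℝ, 0 ≤ t ∧ q = -(t : ℂ) := by
    refine ⟨-q.re, by simpa using hle.1, ?_⟩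
    apply Complex.ext
    · simp
    · simpa using hle.2
  rw [hqt, eq_comm, div_eq_iff h1] at hq
  have ht1 : (1 + t) ≠ 0 := by positivity
  have ht1' : (1 + (t : ℂ)) ≠ 0 := by exact_mod_cast ht1
  refine hz ((1 - t) / (1 + t)) ⟨?_, ?_⟩ ?_
  · rw [le_div_iff₀ (by positivity)]; linarith
  · rw [div_le_iff₀ (by positivity)]; linarith
  · push_cast
    field_simp
    linear_combination hq

lemma mob_val {s v : ℂ} {η : ℝ} (hv : v ≠ 0) (hη : 0 < η) (u : ℝ) :
    (s + u * v - (s + Complex.I * η * v)) / (s + u * v - (s - Complex.I * η * v)) =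
      (((u ^ 2 - η ^ 2) / (u ^ 2 + η ^ 2) : ℝ) : ℂ) +
        ((-(2 * u * η) / (u ^ 2 + η ^ 2) : ℝ) : ℂ) * Complex.I := by
  have h2 : (u : ℂ) + Complex.I * η ≠ 0 := by
    intro h
    have := congrArg Complex.im h
    simp at this
    exact hη.ne' this
  have h0 : s + u * v - (s - Complex.I * η * v) = (u + Complex.I * η) * v := by ring
  have h3 : u ^ 2 + η ^ 2 ≠ 0 := by positivity
  have h3' : (u : ℂ) ^ 2 + (η : ℂ) ^ 2 ≠ 0 := by exact_mod_cast h3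
  rw [h0, div_eq_iff (mul_ne_zero h2 hv)]
  push_cast
  field_simp
  have hI := Complex.I_sq
  linear_combination (2 * u * v * (η : ℂ) ^ 2) * hI

lemma chord {c v : ℂ} {r u : ℝ} (h1 : ‖c + v‖ = r) (h2 : ‖c - v‖ = r) :
    ‖c + u * v‖ ^ 2 = r ^ 2 - (1 - u ^ 2) * ‖v‖ ^ 2 := by
  have e1 : ‖c + v‖ ^ 2 = r ^ 2 := by rw [h1]
  have e2 : ‖c - v‖ ^ 2 = r ^ 2 := by rw [h2]
  rw [Complex.sq_norm, Complex.normSq_apply] at *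
  rw [Complex.sq_norm, Complex.normSq_apply]
  simp only [Complex.add_re, Complex.add_im, Complex.sub_re, Complex.sub_im, Complex.mul_re,
    Complex.mul_im, Complex.ofReal_re, Complex.ofReal_im] at *
  linear_combination ((1 + u) / 2) * e1 + ((1 - u) / 2) * e2

lemma log_of_im_pos {q : ℂ} (h : 0 < q.im) :
    Complex.log q = Complex.log (-q) + Real.pi * Complex.I := by
  simp only [Complex.log, Complex.arg_neg_eq_arg_sub_pi_of_im_pos h, norm_neg]
  push_cast; ring

lemma log_of_im_neg {q : ℂ} (h : q.im < 0) :
    Complex.log q = Complex.log (-q) - Real.pi * Complex.I := by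
  simp only [Complex.log, Complex.arg_neg_eq_arg_add_pi_of_im_neg h, norm_neg]
  push_cast; ring

lemma cut_data {E A B : Set ℂ} {p α α' : ℂ} {r : ℝ} (hE : IsCompact E) (hA : IsCompact A)
    (hB : IsCompact B) (hEAB : IsPreconnected (E ∪ A ∪ B))
    (hAB : Disjoint A B) (hout : ∀ z ∈ E ∪ A ∪ B, r ≤ dist z p)
    (hα : α ∈ A) (hα' : α' ∈ B) (hαr : dist α p = r) (hα'r : dist α' p = r) :
    ∃ S ⊆ Metric.closedBall p r, ∃ xp ∈ Metric.ball p r, ∃ xm ∈ Metric.ball p r,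
      IsCompact S ∧ xp ∉ S ∧ xm ∉ S ∧
      xm ∈ connectedComponentIn (A ∪ S ∪ B)ᶜ xp ∧
      xm ∉ connectedComponentIn (E ∪ (A ∪ S ∪ B))ᶜ xp := by
  have hne : α ≠ α' := fun hh => disjoint_left.1 hAB hα (hh ▸ hα')
  set s := (α + α') / 2 with hs
  set v := (α' - α) / 2 with hv
  have hαs : α = s - v := by rw [hs, hv]; ring
  have hαs' : α' = s + v := by rw [hs, hv]; ring
  have hv0 : v ≠ 0 := by
    intro h0
    rw [h0] at hαs hαs'
    exact hne (by rw [hαs, hαs']; simp)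
  have hvn : 0 < ‖v‖ := norm_pos_iff.2 hv0
  have hr0 : 0 ≤ r := hαr ▸ dist_nonneg
  have hch : ∀ u : ℝ, dist (s + u * v) p ^ 2 = r ^ 2 - (1 - u ^ 2) * ‖v‖ ^ 2 := by
    intro u
    have := chord (c := s - p) (v := v) (r := r) (u := u)
      (by rw [← hα'r, hαs', dist_eq_norm]; congr 1; ring)
      (by rw [← hαr, hαs, dist_eq_norm]; congr 1; ring)
    rw [← this, dist_eq_norm]; congr 2; ring
  have hchlt : ∀ u : ℝ, -1 < u → u < 1 → dist (s + u * v) p < r := by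
    intro u h1 h2
    refine lt_of_pow_lt_pow_left₀ 2 hr0 ?_
    rw [hch u]
    have : 0 < (1 - u ^ 2) * ‖v‖ ^ 2 := mul_pos (by nlinarith) (by positivity)
    linarith
  have hchle : ∀ u ∈ Icc (-1 : ℝ) 1, dist (s + u * v) p ≤ r := by
    intro u hu
    refine le_of_sq_le_sq ?_ hr0
    rw [hch u]
    have : 0 ≤ (1 - u ^ 2) * ‖v‖ ^ 2 := mul_nonneg (by nlinarith [hu.1, hu.2]) (by positivity)
    linarith
  have hsp : dist s p < r := by simpa using hchlt 0 (by norm_num) (by norm_num)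
  set η := (r - dist s p) / (2 * ‖v‖) with hη
  have hη0 : 0 < η := by apply div_pos <;> linarith
  have hηv : η * ‖v‖ = (r - dist s p) / 2 := by rw [hη]; field_simp
  have hcore : ∀ u ∈ Icc (-1 : ℝ) 1, dist (s + u * (Complex.I * η * v)) p < r := by
    intro u hu
    have h1 : dist (s + u * (Complex.I * η * v)) p ≤ dist s p + |u| * (η * ‖v‖) := by
      rw [dist_eq_norm, dist_eq_norm]
      have : s + u * (Complex.I * η * v) - p = (s - p) + u * (Complex.I * η * v) := by ring
      rw [this]
      refine (norm_add_le _ _).trans ?_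
      simp [abs_of_pos hη0]
    have h2 : |u| ≤ 1 := abs_le.2 hu
    have h3 : |u| * (η * ‖v‖) ≤ 1 * (η * ‖v‖) := by gcongr
    linarith
  set xp := s + Complex.I * η * v with hxp
  set xm := s - Complex.I * η * v with hxm
  have hxpb : dist xp p < r := by simpa using hcore 1 (by norm_num)
  have hxmb : dist xm p < r := by
    have := hcore (-1) (by norm_num)
    rw [hxm]; convert this using 2; push_cast; ring
  let f : ℝ → ℂ := fun u => s + u * v
  have hf : Continuous f := by fun_prop
  let S := f '' Icc (-1) 1
  have hSc : IsCompact S := isCompact_Icc.image hf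
  have hSp : IsPreconnected S := isPreconnected_Icc.image f hf.continuousOn
  have hSmem : ∀ z ∈ S, r ≤ dist z p → z = α ∨ z = α' := by
    rintro _ ⟨u, hu, rfl⟩ hz
    rcases hu.1.lt_or_eq with h1 | rfl
    · rcases hu.2.lt_or_eq with h2 | rfl
      · exact absurd (hchlt u h1 h2) (not_lt.2 hz)
      · right; rw [hαs']; simp [f]
    · left; rw [hαs]; simp [f]; ring
  have hαS : α ∈ S := ⟨-1, by norm_num, by rw [hαs]; simp [f]; ring⟩
  have hαS' : α' ∈ S := ⟨1, by norm_num, by rw [hαs']; simp [f]⟩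
  let g : ℂ → ℂ := fun z => (z - xp) / (z - xm)
  have hgS : ∀ u : ℝ, g (f u) = (((u ^ 2 - η ^ 2) / (u ^ 2 + η ^ 2) : ℝ) : ℂ) +
        ((-(2 * u * η) / (u ^ 2 + η ^ 2) : ℝ) : ℂ) * Complex.I := fun u => mob_val hv0 hη0 u
  have hgre : ∀ u : ℝ, (g (f u)).re = (u ^ 2 - η ^ 2) / (u ^ 2 + η ^ 2) := by
    intro u; rw [hgS]; simp only [Complex.add_re, Complex.mul_re, Complex.ofReal_re,
      Complex.ofReal_im, Complex.I_re, Complex.I_im]; ring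
  have hgim : ∀ u : ℝ, (g (f u)).im = -(2 * u * η) / (u ^ 2 + η ^ 2) := by
    intro u; rw [hgS]; simp only [Complex.add_im, Complex.mul_im, Complex.ofReal_re,
      Complex.ofReal_im, Complex.I_re, Complex.I_im]; ring
  have hslS : ∀ z ∈ S, -g z ∈ Complex.slitPlane := by
    rintro _ ⟨u, hu, rfl⟩
    rw [Complex.mem_slitPlane_iff]
    by_cases hu0 : u = 0
    · left
      rw [Complex.neg_re, hgre, hu0]
      have : 0 < η ^ 2 := by positivity
      simp [this.ne']
    · right
      rw [Complex.neg_im, hgim]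
      have : u ^ 2 + η ^ 2 ≠ 0 := by positivity
      simp [hu0, hη0.ne', this]
  have hsl : ∀ z ∈ E ∪ A ∪ B, g z ∈ Complex.slitPlane := by
    intro z hz
    refine mob_slit fun u hu h0 => ?_
    have := hout z hz
    rw [h0] at this
    exact absurd (hcore u hu) (not_lt.2 this)
  have hxpS : xp ∉ S := by
    intro hh
    have := hslS _ hh
    rw [show g xp = 0 by simp [g]] at this
    simp at this
  have hxmS : xm ∉ S := by
    intro hh
    have := hslS _ hh
    rw [show g xm = 0 by simp [g]] at this
    simp at this
  have hgc : ∀ T : Set ℂ, xm ∉ T → ContinuousOn g T := by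
    intro T hT
    refine ContinuousOn.div (by fun_prop) (by fun_prop) fun z hz h0 => hT ?_
    rw [← sub_eq_zero.1 h0]; exact hz
  have hxpo : xp ∉ E ∪ A ∪ B := fun hh => absurd hxpb (not_lt.2 (hout _ hh))
  have hxmo : xm ∉ E ∪ A ∪ B := fun hh => absurd hxmb (not_lt.2 (hout _ hh))
  have hl0 : ContinuousOn (fun z => Complex.log (g z)) (E ∪ A ∪ B) := (hgc _ hxmo).clog hsl
  have hl1 : ContinuousOn (fun z => Complex.log (-g z)) S := (hgc _ hxmS).neg.clog hslS
  have hlα : Complex.log (g α) = Complex.log (-g α) + Real.pi * Complex.I := by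
    apply log_of_im_pos
    have : α = f (-1) := by rw [hαs]; simp [f]; ring
    rw [this, hgim]
    apply div_pos <;> nlinarith
  have hlα' : Complex.log (g α') = Complex.log (-g α') - Real.pi * Complex.I := by
    apply log_of_im_neg
    have : α' = f 1 := by rw [hαs']; simp [f]
    rw [this, hgim]
    apply div_neg_of_neg_of_pos <;> nlinarith
  have hS1 : HasLog g S := by
    refine ⟨fun z => Complex.log (-g z) + Real.pi * Complex.I, hl1.add continuousOn_const, ?_⟩
    intro z hz
    rw [Complex.exp_add, Complex.exp_log (Complex.slitPlane_ne_zero (hslS z hz)),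
      Complex.exp_pi_mul_I]
    ring
  have hA1 : HasLog g A := hasLog_of_slit (hgc _ fun hh => hxmo (.inl (.inr hh)))
    fun z hz => hsl z (.inl (.inr hz))
  have hB1 : HasLog g B := hasLog_of_slit (hgc _ fun hh => hxmo (.inr hh))
    fun z hz => hsl z (.inr hz)
  refine ⟨S, ?_, xp, hxpb, xm, hxmb, hSc, hxpS, hxmS, ?_, ?_⟩
  · rintro _ ⟨u, hu, rfl⟩
    exact hchle u hu
  · refine joined_of_hasLog ((hA.union hSc).union hB) ?_ ?_ ?_
    · rintro ((hh | hh) | hh)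
      exacts [hxpo (.inl (.inr hh)), hxpS hh, hxpo (.inr hh)]
    · rintro ((hh | hh) | hh)
      exacts [hxmo (.inl (.inr hh)), hxmS hh, hxmo (.inr hh)]
    · have e1 : A ∩ S = {α} := by
        apply subset_antisymm
        · rintro z ⟨hzA, hzS⟩
          rcases hSmem z hzS (hout z (.inl (.inr hzA))) with h1 | h1
          · exact h1
          · exact absurd hα' (disjoint_left.1 hAB (h1 ▸ hzA))
        · rintro _ rfl; exact ⟨hα, hαS⟩
      have e2 : (A ∪ S) ∩ B = {α'} := by
        apply subset_antisymm
        · rintro z ⟨hzA | hzS, hzB⟩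
          · exact absurd hzB (disjoint_left.1 hAB hzA)
          rcases hSmem z hzS (hout z (.inr hzB)) with h1 | h1
          · exact absurd hzB (disjoint_left.1 hAB (h1 ▸ hα))
          · exact h1
        · rintro _ rfl; exact ⟨.inr hαS', hα'⟩
      refine (hA1.union hS1 hA.isClosed hSc.isClosed ?_).union hB1
        (hA.union hSc).isClosed hB.isClosed ?_
      · rw [e1]; exact isPreconnected_singleton
      · rw [e2]; exact isPreconnected_singleton
  · intro hmem
    have hKc : IsClosed (E ∪ (A ∪ S ∪ B)) := (hE.union ((hA.union hSc).union hB)).isClosed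
    obtain ⟨L, hL, hL1⟩ := hasLog_of_joined hKc isPreconnected_connectedComponentIn
      (connectedComponentIn_subset _ _) (mem_connectedComponentIn (x := xp) (by
        rintro (hh | ((hh | hh) | hh))
        exacts [hxpo (.inl (.inl hh)), hxpo (.inl (.inr hh)), hxpS hh, hxpo (.inr hh)])) hmem
    have hs1 : E ∪ A ∪ B ⊆ E ∪ (A ∪ S ∪ B) := by
      rintro z ((hz | hz) | hz)
      exacts [.inl hz, .inr (.inl (.inl hz)), .inr (.inr hz)]
    have hs2 : S ⊆ E ∪ (A ∪ S ∪ B) := fun z hz => .inr (.inl (.inr hz))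
    have k1 := const_of_exp (h := fun z => L z - Complex.log (g z)) (c := 1) hEAB
      ((hL.mono hs1).sub hl0) (by
        intro z hz
        have h0 := Complex.slitPlane_ne_zero (hsl z hz)
        show Complex.exp (L z - Complex.log (g z)) = 1
        rw [Complex.exp_sub, hL1 z (hs1 hz), Complex.exp_log h0]
        exact div_self h0) (.inl (.inr hα)) (.inr hα')
    have k2 := const_of_exp (h := fun z => L z - Complex.log (-g z)) (c := -1) hSp
      ((hL.mono hs2).sub hl1) (by
        intro z hz
        have h0 := Complex.slitPlane_ne_zero (hslS z hz)
        show Complex.exp (L z - Complex.log (-g z)) = -1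
        rw [Complex.exp_sub, hL1 z (hs2 hz), Complex.exp_log h0]
        rw [div_eq_iff h0]
        show g z = _
        ring) hαS hαS'
    rw [hlα, hlα'] at k1
    have : (Real.pi : ℂ) * Complex.I = 0 := by linear_combination (k2 - k1) / 2
    simp [Real.pi_ne_zero] at this

lemma Setup.pair_sep {E R : Set ℂ} (h : Setup E R) {a b : ℂ} (ha : a ∈ frontier R)
    (hb : b ∈ frontier R) (hab : a ≠ b) : ¬ IsPreconnected (frontier R \ {a, b}) := by
  obtain ⟨p, r, A, B, α, α', hr, hball, hA, hB, hAp, hBp, hAB, haA, hbB, hAR, hBR, hAo, hBo,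
    hα, hα', hαr, hα'r⟩ := h.crosscut ha hb hab
  have haE := h.Rfr ha
  have hbE := h.Rfr hb
  have hEo : ∀ z ∈ E, r ≤ dist z p := by
    intro z hz
    by_contra hlt
    exact h.Rdisj (hball (not_le.1 hlt).le) hz
  have hpre : IsPreconnected (E ∪ A ∪ B) :=
    (h.conn.union a haE haA hAp).union b (.inl hbE) hbB hBp
  obtain ⟨S, hSb, xp, hxp, xm, hxm, hSc, hxpS, hxmS, hjoin, hsep⟩ :=
    cut_data h.cpt hA hB hpre hAB (by
      rintro z ((hz | hz) | hz)
      exacts [hEo z hz, hAo z hz, hBo z hz]) hα hα' hαr hα'r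
  set Γ := A ∪ S ∪ B with hΓ
  have hΓc : IsCompact Γ := (hA.union hSc).union hB
  have hΓR : ∀ z ∈ Γ, z ∈ R ∨ z = a ∨ z = b := by
    rintro z ((hz | hz) | hz)
    · rcases hAR hz with hz | hz
      exacts [.inr (.inl hz), .inl hz]
    · exact .inl (hball (hSb hz))
    · rcases hBR hz with hz | hz
      exacts [.inr (.inr hz), .inl hz]
  have hΓx : ∀ x ∈ Metric.ball p r, x ∉ S → x ∉ Γ := by
    rintro x hx hxS ((hz | hz) | hz)
    exacts [absurd hx (not_lt.2 (hAo x hz)), hxS hz, absurd hx (not_lt.2 (hBo x hz))]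
  have hxpR : xp ∈ R := hball (Metric.ball_subset_closedBall hxp)
  have hxmR : xm ∈ R := hball (Metric.ball_subset_closedBall hxm)
  have hKc : IsClosed (E ∪ Γ) := (h.cpt.union hΓc).isClosed
  set O := connectedComponentIn (E ∪ Γ)ᶜ xp with hO
  have hOo : IsOpen O := hKc.isOpen_compl.connectedComponentIn
  have hOsub : O ⊆ (E ∪ Γ)ᶜ := connectedComponentIn_subset _ _
  have hxpO : xp ∈ O := mem_connectedComponentIn (by
    rintro (hh | hh)
    exacts [h.Rdisj hxpR hh, hΓx xp hxp hxpS hh])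
  have hOR : O ⊆ R := h.maximal isPreconnected_connectedComponentIn
    (fun z hz hzE => hOsub hz (.inl hzE)) hxpO hxpR
  have hOfr : frontier O ⊆ E ∪ Γ := frontier_comp hKc xp
  set U := (R \ Γ) \ O with hU
  have hUeq : U = (R \ Γ) \ closure O := by
    apply subset_antisymm
    · rintro z ⟨⟨hzR, hzΓ⟩, hzO⟩
      refine ⟨⟨hzR, hzΓ⟩, fun hcl => ?_⟩
      have : z ∈ frontier O := ⟨hcl, by rwa [hOo.interior_eq]⟩
      rcases hOfr this with h1 | h1
      exacts [h.Rdisj hzR h1, hzΓ h1]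
    · rintro z ⟨hz, hzO⟩
      exact ⟨hz, fun hh => hzO (subset_closure hh)⟩
  have hUo : IsOpen U := by
    rw [hUeq]
    exact (h.Ropen.sdiff hΓc.isClosed).sdiff isClosed_closure
  have hxmU : xm ∈ U := ⟨⟨hxmR, hΓx xm hxm hxmS⟩, hsep⟩
  have hRcov : R ⊆ O ∪ U ∪ Γ := by
    intro z hz
    by_cases h1 : z ∈ Γ
    · exact .inr h1
    by_cases h2 : z ∈ O
    · exact .inl (.inl h2)
    · exact .inl (.inr ⟨⟨hz, h1⟩, h2⟩)
  have hUR : U ⊆ R := fun z hz => hz.1.1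
  have hnotR : ∀ c ∈ frontier R, c ∉ R := fun c hc hcR => h.Rdisj hcR (h.Rfr hc)
  have hΓfr : ∀ c ∈ frontier R \ {a, b}, c ∉ Γ := by
    rintro c ⟨hc, hcab⟩ hcΓ
    rcases hΓR c hcΓ with h1 | h1
    · exact hnotR c hc h1
    · exact hcab h1
  have hjp : xp ∈ connectedComponentIn Γᶜ xp := mem_connectedComponentIn (hΓx xp hxp hxpS)
  have key : ∀ V : Set ℂ, IsOpen V → V ⊆ R → frontier V ⊆ E ∪ Γ → ∀ x ∈ V, ∀ y ∉ V,
      x ∈ connectedComponentIn Γᶜ xp → y ∈ connectedComponentIn Γᶜ xp →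
      (frontier R \ {a, b} ∩ closure V).Nonempty := by
    intro V hVo hVR hVfr x hxV y hyV hx hy
    obtain ⟨z, hz, hzf⟩ := frontier_inter isPreconnected_connectedComponentIn hx hy hxV hyV
    have hzΓ : z ∉ Γ := connectedComponentIn_subset _ _ hz
    have hzE : z ∈ E := (hVfr hzf).resolve_right hzΓ
    have hzcl : z ∈ closure V := frontier_subset_closure hzf
    refine ⟨z, ⟨⟨closure_mono hVR hzcl, ?_⟩, ?_⟩, hzcl⟩
    · rw [h.Ropen.interior_eq]; exact fun hh => h.Rdisj hh hzE
    · rintro (rfl | hh)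
      · exact hzΓ (.inl (.inl haA))
      · rw [mem_singleton_iff] at hh
        rw [hh] at hzΓ
        exact hzΓ (.inr hbB)
  have hUfr : frontier U ⊆ E ∪ Γ := by
    rintro z hz
    have hzU : z ∉ U := by
      have := hz.2
      rwa [hUo.interior_eq] at this
    have hzR : z ∈ closure R := closure_mono hUR hz.1
    by_cases hzR' : z ∈ R
    · rcases hRcov hzR' with (h1 | h1) | h1
      · exfalso
        obtain ⟨w, hwO, hwU⟩ := mem_closure_iff.1 hz.1 O hOo h1
        exact hwU.2 hwO
      · exact absurd h1 hzU
      · exact .inr h1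
    · exact .inl (h.Rfr ⟨hzR, by rwa [h.Ropen.interior_eq]⟩)
  intro hcon
  rw [isPreconnected_closed_iff] at hcon
  obtain ⟨c, hc, hcO, hcU⟩ := hcon (closure O) (closure U) isClosed_closure isClosed_closure (by
    intro c hc
    have h1 : c ∈ closure (O ∪ U ∪ Γ) := closure_mono hRcov hc.1.1
    rw [closure_union, closure_union, hΓc.isClosed.closure_eq] at h1
    exact h1.resolve_right (hΓfr c hc))
    (key O hOo hOR hOfr xp hxpO xm hsep hjp hjoin)
    (key U hUo hUR hUfr xm hxmU xp (fun hh => hh.2 hxpO) hjoin hjp)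
  obtain ⟨ε, hε, hεΓ⟩ := Metric.mem_nhds_iff.1 (hΓc.isClosed.isOpen_compl.mem_nhds (hΓfr c hc))
  obtain ⟨δ, hδ, hulc⟩ := h.ulc (a := c) hε
  obtain ⟨x, hxO, hxd⟩ := Metric.mem_closure_iff.1 hcO δ hδ
  obtain ⟨y, hyU, hyd⟩ := Metric.mem_closure_iff.1 hcU δ hδ
  obtain ⟨γ, hγ⟩ := hulc x (hOR hxO) y (hUR hyU) (by rwa [dist_comm]) (by rwa [dist_comm])
  obtain ⟨z, ⟨t, rfl⟩, hzf⟩ := frontier_inter (isPreconnected_range γ.continuous)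
    ⟨0, γ.source⟩ ⟨1, γ.target⟩ hxO hyU.2
  rcases hOfr hzf with h1 | h1
  · exact h.Rdisj (hγ t).1 h1
  · exact hεΓ (hγ t).2 h1


/-- A separable connected space with an order whose rays are open and which has
end points is mapped continuously and bijectively onto the unit interval. -/
lemma arc_of_order {Y : Type*} [TopologicalSpace Y] [LinearOrder Y] [PreconnectedSpace Y]
    [TopologicalSpace.SeparableSpace Y] (hI : ∀ y : Y, IsOpen (Iio y)) (hJ : ∀ y : Y, IsOpen (Ioi y))
    {a b : Y} (ha : ∀ y, a ≤ y) (hb : ∀ y, y ≤ b) (hab : a ≠ b) :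
    ∃ f : Y → ℝ, Continuous f ∧ Function.Injective f ∧ range f = Icc 0 1 ∧ f a = 0 ∧ f b = 1 := by
  have hdo : ∀ x y : Y, x < y → (Ioo x y).Nonempty := by
    intro x y hxy
    obtain ⟨z, -, hz⟩ := isPreconnected_univ (Iio y) (Ioi x) (hI y) (hJ x)
      (fun z _ => by
        rcases lt_or_ge z y with h | h
        exacts [.inl h, .inr (hxy.trans_le h)])
      ⟨x, trivial, hxy⟩ ⟨y, trivial, hxy⟩
    exact ⟨z, hz.2, hz.1⟩
  obtain ⟨D0, hD0c, hD0⟩ := TopologicalSpace.exists_countable_dense Y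
  let D : Set Y := {d ∈ D0 | d ≠ a ∧ d ≠ b}
  have hD : ∀ x y : Y, x < y → ∃ d : D, x < d ∧ (d : Y) < y := by
    intro x y hxy
    obtain ⟨d, hd, hdD⟩ := hD0.inter_open_nonempty (Ioo x y) ((hJ x).inter (hI y)) (hdo x y hxy)
    refine ⟨⟨d, hdD, ?_, ?_⟩, hd.1, hd.2⟩
    · exact ((ha x).trans_lt hd.1).ne'
    · exact (hd.2.trans_le (hb y)).ne
  have hab' : a < b := lt_of_le_of_ne (ha b) hab
  have haD : ∀ d : D, a < d := fun d => lt_of_le_of_ne (ha _) d.2.2.1.symm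
  have hbD : ∀ d : D, (d : Y) < b := fun d => lt_of_le_of_ne (hb _) d.2.2.2
  have : Countable D := (hD0c.mono (sep_subset _ _)).to_subtype
  have : Nonempty D := ⟨(hD a b hab').choose⟩
  have : DenselyOrdered D := ⟨fun x y hxy => by
    obtain ⟨d, h1, h2⟩ := hD x y hxy
    exact ⟨d, h1, h2⟩⟩
  have : NoMinOrder D := ⟨fun x => by
    obtain ⟨d, h1, h2⟩ := hD a x (haD x)
    exact ⟨d, h2⟩⟩
  have : NoMaxOrder D := ⟨fun x => by
    obtain ⟨d, h1, h2⟩ := hD x b (hbD x)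
    exact ⟨d, h1⟩⟩
  have : Nonempty (Ioo (0 : ℚ) 1) := ⟨⟨1 / 2, by norm_num⟩⟩
  obtain ⟨e⟩ := Order.iso_of_countable_dense D (Ioo (0 : ℚ) 1)
  let ev : D → ℝ := fun d => ((e d : ℚ) : ℝ)
  have ev0 : ∀ d, 0 < ev d := fun d => by
    show (0 : ℝ) < ((e d : ℚ) : ℝ)
    exact_mod_cast (e d).2.1
  have ev1 : ∀ d, ev d < 1 := fun d => by
    show ((e d : ℚ) : ℝ) < 1
    exact_mod_cast (e d).2.2
  have evm : ∀ d d' : D, (d : Y) < d' → ev d < ev d' := by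
    intro d d' hdd
    have : e d < e d' := e.lt_iff_lt.2 hdd
    show ((e d : ℚ) : ℝ) < ((e d' : ℚ) : ℝ)
    exact_mod_cast this
  have evs : ∀ x y : ℝ, 0 ≤ x → y ≤ 1 → x < y → ∃ d, x < ev d ∧ ev d < y := by
    intro x y hx hy hxy
    obtain ⟨q, h1, h2⟩ := exists_rat_btwn hxy
    have q0 : 0 < q := by
      have : (0 : ℝ) < q := by linarith
      exact_mod_cast this
    have q1 : q < 1 := by
      have : (q : ℝ) < 1 := by linarith
      exact_mod_cast this
    refine ⟨e.symm ⟨q, q0, q1⟩, ?_, ?_⟩ <;> simpa [ev] using by assumption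
  let W : Y → Set ℝ := fun x => insert 0 (ev '' {d : D | (d : Y) < x})
  let f : Y → ℝ := fun x => sSup (W x)
  have hWb : ∀ x, BddAbove (W x) := by
    intro x
    refine ⟨1, ?_⟩
    rintro _ (rfl | ⟨d, -, rfl⟩)
    exacts [zero_le_one, (ev1 d).le]
  have hWn : ∀ x, (W x).Nonempty := fun x => ⟨0, .inl rfl⟩
  have hf0 : ∀ x, 0 ≤ f x := fun x => le_csSup (hWb x) (.inl rfl)
  have hf1 : ∀ x, f x ≤ 1 := fun x => csSup_le (hWn x) (by
    rintro _ (rfl | ⟨d, -, rfl⟩)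
    exacts [zero_le_one, (ev1 d).le])
  have hfl : ∀ x (d : D), (d : Y) < x → ev d ≤ f x := fun x d hd =>
    le_csSup (hWb x) (.inr ⟨d, hd, rfl⟩)
  have hfu : ∀ x (d : D), x ≤ (d : Y) → f x ≤ ev d := fun x d hd =>
    csSup_le (hWn x) (by
      rintro _ (rfl | ⟨d', hd', rfl⟩)
      exacts [(ev0 d).le, (evm d' d (lt_of_lt_of_le hd' hd)).le])
  have hlt : ∀ x c, 0 ≤ c → c < f x → ∃ d : D, (d : Y) < x ∧ c < ev d := by
    intro x c hc hcx
    obtain ⟨d, h1, h2⟩ := evs c (f x) hc (hf1 x) hcx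
    refine ⟨d, ?_, h1⟩
    by_contra hle
    exact absurd (hfu x d (not_lt.1 hle)) (not_le.2 h2)
  have hfm : StrictMono f := by
    intro x y hxy
    obtain ⟨d, h1, h2⟩ := hD x y hxy
    obtain ⟨d', h3, h4⟩ := hD d y h2
    exact (hfu x d h1.le).trans_lt ((evm d d' h3).trans_le (hfl y d' h4))
  have hfa : f a = 0 := by
    refine le_antisymm (csSup_le (hWn a) ?_) (hf0 a)
    rintro _ (rfl | ⟨d, hd, rfl⟩)
    · exact le_rfl
    · exact absurd hd (not_lt.2 (ha _))
  have hfb : f b = 1 := by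
    refine le_antisymm (hf1 b) ?_
    by_contra hh
    obtain ⟨d, h1, h2⟩ := evs (f b) 1 (hf0 b) le_rfl (not_le.1 hh)
    exact absurd (hfl b d (hbD d)) (not_le.2 h1)
  have hfc : Continuous f := by
    rw [continuous_iff_continuousAt]
    intro x
    rw [ContinuousAt, tendsto_order]
    constructor
    · intro c hc
      rcases lt_or_ge c 0 with h0 | h0
      · exact Eventually.of_forall fun y => h0.trans_le (hf0 y)
      obtain ⟨d, h1, h2⟩ := hlt x c h0 hc
      filter_upwards [(hJ d).mem_nhds h1] with y hy
      exact h2.trans_le (hfl y d hy)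
    · intro c hc
      rcases lt_or_ge 1 c with h0 | h0
      · exact Eventually.of_forall fun y => (hf1 y).trans_lt h0
      obtain ⟨d, h1, h2⟩ := evs (f x) c (hf0 x) h0 hc
      have hxd : x < d := by
        rcases lt_or_eq_of_le (not_lt.1 fun hdx : (d : Y) < x =>
          absurd (hfl x d hdx) (not_le.2 h1)) with h | h
        · exact h
        · obtain ⟨d', h3, h4⟩ := evs (f x) (ev d) (hf0 x) (ev1 d).le h1
          rcases lt_or_ge (d' : Y) x with h5 | h5
          · exact absurd (hfl x d' h5) (not_le.2 h3)
          · rw [h] at h5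
            rcases h5.lt_or_eq with h6 | h6
            · exact absurd (evm d d' h6) (not_lt.2 h4.le)
            · rw [Subtype.ext h6] at h4
              exact absurd h4 (lt_irrefl _)
      filter_upwards [(hI d).mem_nhds hxd] with y hy
      exact (hfu y d (le_of_lt hy)).trans_lt h2
  refine ⟨f, hfc, hfm.injective, ?_, hfa, hfb⟩
  apply subset_antisymm
  · rintro _ ⟨x, rfl⟩
    exact ⟨hf0 x, hf1 x⟩
  · have := (isPreconnected_range hfc).ordConnected.out (mem_range_self a) (mem_range_self b)
    rwa [hfa, hfb] at this

/-- Comparison of two cuts. -/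
lemma cut_core {Y : Type*} [TopologicalSpace Y] [T1Space Y] [PreconnectedSpace Y] {a b : Y}
    (h3 : ∀ (x : Y) (T : Set Y), IsOpen T → IsClosed (insert x T) → x ∉ T → a ∉ T → b ∉ T → T = ∅)
    {x y : Y} {G H G' H' : Set Y} (oG : IsOpen G) (oH : IsOpen H) (oG' : IsOpen G') (oH' : IsOpen H')
    (aG : a ∈ G) (aG' : a ∈ G') (bH : b ∈ H) (bH' : b ∈ H') (dG : Disjoint G H)
    (dG' : Disjoint G' H') (u : G ∪ H = {x}ᶜ) (u' : G' ∪ H' = {y}ᶜ) (hx : x ∈ G') :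
    G ⊆ G' ∧ y ∉ G := by
  have main : ∀ {x y : Y} {G H G' H' : Set Y}, IsOpen G → IsOpen H → IsOpen G' → IsOpen H' →
      a ∈ G → a ∈ G' → b ∈ H → b ∈ H' → Disjoint G H → Disjoint G' H' → G ∪ H = {x}ᶜ →
      G' ∪ H' = {y}ᶜ → x ∈ G' → G ∩ H' = ∅ := by
    intro x y G H G' H' oG oH oG' oH' aG aG' bH bH' dG dG' u u' hx
    have e1 : insert x G = Hᶜ := by
      ext z
      have := Set.ext_iff.1 u z
      have hd : z ∈ G → z ∉ H := fun hz => disjoint_left.1 dG hz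
      simp only [mem_union, mem_compl_iff, mem_singleton_iff, mem_insert_iff] at *
      have hxx := Set.ext_iff.1 u x
      simp only [mem_union, mem_compl_iff, mem_singleton_iff] at hxx
      by_cases hz : z = x
      · subst hz; tauto
      · tauto
    have e2 : insert y H' = G'ᶜ := by
      ext z
      have := Set.ext_iff.1 u' z
      have hd : z ∈ G' → z ∉ H' := fun hz => disjoint_left.1 dG' hz
      have hxx := Set.ext_iff.1 u' y
      simp only [mem_union, mem_compl_iff, mem_singleton_iff, mem_insert_iff] at *
      by_cases hz : z = y
      · subst hz; tauto
      · tauto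
    have hy : y ∉ H' := by
      intro hh
      have : y ∈ ({y}ᶜ : Set Y) := u' ▸ Or.inr hh
      exact this rfl
    refine h3 y (G ∩ H') (oG.inter oH') ?_ (fun hh => hy hh.2)
      (fun hh => disjoint_left.1 dG' aG' hh.2) (fun hh => disjoint_left.1 dG hh.1 bH)
    have c : IsClosed ((insert x G ∩ insert y H') ∪ {y}) := by
      rw [e1, e2]
      exact (oH.isClosed_compl.inter oG'.isClosed_compl).union isClosed_singleton
    convert c using 1
    ext z
    have hxH : x ∉ H' := disjoint_left.1 dG' hx
    simp only [mem_union, mem_inter_iff, mem_singleton_iff, mem_insert_iff]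
    constructor
    · tauto
    · rintro (⟨rfl | h1, rfl | h2⟩ | h1)
      · tauto
      · exact absurd h2 hxH
      · tauto
      · tauto
      · tauto
  have k1 := main oG oH oG' oH' aG aG' bH bH' dG dG' u u' hx
  have hyG : y ∉ G := by
    intro hy
    have k2 := main oG' oH' oG oH aG' aG bH' bH dG' dG u' u hy
    have hcl : IsClosed H := by
      have : H = Gᶜ ∩ G'ᶜ := by
        apply subset_antisymm
        · intro z hz
          refine ⟨disjoint_right.1 dG hz, fun hz' => ?_⟩
          exact (k2 ▸ (⟨hz', hz⟩ : z ∈ G' ∩ H) : z ∈ (∅ : Set Y))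
        · rintro z ⟨h1, h2⟩
          by_contra h3
          have hzx : z = x := by
            by_contra hzx
            have : z ∈ G ∪ H := u ▸ hzx
            exact this.elim h1 h3
          exact h2 (hzx ▸ hx)
      rw [this]
      exact oG.isClosed_compl.inter oG'.isClosed_compl
    rcases isClopen_iff.1 ⟨hcl, oH⟩ with h | h
    · exact (h ▸ bH : b ∈ (∅ : Set Y))
    · exact disjoint_left.1 dG aG (h ▸ trivial)
  refine ⟨fun z hz => ?_, hyG⟩
  have hzy : z ≠ y := fun h => hyG (h ▸ hz)
  have : z ∈ G' ∪ H' := u' ▸ hzy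
  rcases this with h | h
  · exact h
  · exact ((k1 ▸ (⟨hz, h⟩ : z ∈ G ∩ H') : z ∈ (∅ : Set Y))).elim

lemma arc_type {Y : Type*} [TopologicalSpace Y] [T1Space Y] [PreconnectedSpace Y]
    [TopologicalSpace.SeparableSpace Y] {a b : Y} (hab : a ≠ b)
    (h2 : ∀ x, x ≠ a → x ≠ b → ∃ G H : Set Y, IsOpen G ∧ IsOpen H ∧ a ∈ G ∧ b ∈ H ∧ Disjoint G H ∧
      G ∪ H = {x}ᶜ)
    (h3 : ∀ (x : Y) (T : Set Y), IsOpen T → IsClosed (insert x T) → x ∉ T → a ∉ T → b ∉ T →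
      T = ∅) :
    ∃ f : Y → ℝ, Continuous f ∧ Function.Injective f ∧ range f = Icc 0 1 ∧ f a = 0 ∧ f b = 1 := by
  classical
  choose! G0 H0 oG oH aG bH dG u using h2
  let G : Y → Set Y := fun y => if y = a then ∅ else if y = b then {b}ᶜ else G0 y
  have Ga : G a = ∅ := by simp [G]
  have Gb : G b = {b}ᶜ := by simp [G, hab.symm]
  have Gy : ∀ y, y ≠ a → y ≠ b → G y = G0 y := fun y h1 h2 => by simp [G, h1, h2]
  have hirr : ∀ y, y ∉ G y := by
    intro y hy
    by_cases h1 : y = a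
    · rw [h1, Ga] at hy; exact hy
    by_cases h2 : y = b
    · rw [h2, Gb] at hy; exact hy rfl
    rw [Gy y h1 h2] at hy
    have : y ∈ ({y}ᶜ : Set Y) := u y h1 h2 ▸ Or.inl hy
    exact this rfl
  have hop : ∀ y, IsOpen (G y) := by
    intro y
    by_cases h1 : y = a
    · rw [h1, Ga]; exact isOpen_empty
    by_cases h2 : y = b
    · rw [h2, Gb]; exact isOpen_compl_singleton
    rw [Gy y h1 h2]; exact oG y h1 h2
  have hcl : ∀ y, IsClosed (insert y (G y)) := by
    intro y
    by_cases h1 : y = a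
    · rw [h1, Ga]; simp
    by_cases h2 : y = b
    · rw [h2, Gb]
      have : insert b ({b}ᶜ : Set Y) = univ := by ext z; simp [em]
      rw [this]; exact isClosed_univ
    rw [Gy y h1 h2]
    have : insert y (G0 y) = (H0 y)ᶜ := by
      ext z
      have hd : z ∈ G0 y → z ∉ H0 y := fun hz => disjoint_left.1 (dG y h1 h2) hz
      have k1 := Set.ext_iff.1 (u y h1 h2) z
      have k2 := Set.ext_iff.1 (u y h1 h2) y
      simp only [mem_union, mem_compl_iff, mem_singleton_iff, mem_insert_iff] at *
      by_cases hz : z = y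
      · subst hz; tauto
      · tauto
    rw [this]
    exact (oH y h1 h2).isClosed_compl
  have haG : ∀ y, y ≠ a → a ∈ G y := by
    intro y h1
    by_cases h2 : y = b
    · rw [h2, Gb]; exact hab
    rw [Gy y h1 h2]; exact aG y h1 h2
  have hbG : ∀ y, b ∉ G y := by
    intro y hy
    by_cases h1 : y = a
    · rw [h1, Ga] at hy; exact hy
    by_cases h2 : y = b
    · rw [h2, Gb] at hy; exact hy rfl
    rw [Gy y h1 h2] at hy
    exact disjoint_left.1 (dG y h1 h2) hy (bH y h1 h2)
  have hsub : ∀ x y, x ∈ G y → G x ⊆ G y := by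
    intro x y hxy
    by_cases hx1 : x = a
    · rw [hx1, Ga]; exact empty_subset _
    by_cases hx2 : x = b
    · exact absurd (hx2 ▸ hxy) (hbG y)
    by_cases hy1 : y = a
    · rw [hy1, Ga] at hxy; exact hxy.elim
    by_cases hy2 : y = b
    · rw [hy2, Gb]
      intro z hz hzb
      rw [mem_singleton_iff] at hzb
      exact hbG x (hzb ▸ hz)
    rw [Gy x hx1 hx2, Gy y hy1 hy2]
    rw [Gy y hy1 hy2] at hxy
    exact (cut_core h3 (oG x hx1 hx2) (oH x hx1 hx2) (oG y hy1 hy2) (oH y hy1 hy2) (aG x hx1 hx2)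
      (aG y hy1 hy2) (bH x hx1 hx2) (bH y hy1 hy2) (dG x hx1 hx2) (dG y hy1 hy2) (u x hx1 hx2)
      (u y hy1 hy2) hxy).1
  have htri : ∀ x y, x ≠ y → x ∉ G y → y ∈ G x := by
    intro x y hne hxy
    by_cases hx1 : x = a
    · rw [hx1] at hxy; exact absurd (haG y fun h => hne (hx1.trans h.symm)) hxy
    by_cases hx2 : x = b
    · rw [hx2, Gb]; rintro h; exact hne (hx2.trans h.symm)
    by_cases hy1 : y = a
    · rw [hy1]; exact haG x hx1
    by_cases hy2 : y = b
    · rw [hy2, Gb] at hxy; exact absurd hx2 hxy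
    rw [Gy x hx1 hx2]
    rw [Gy y hy1 hy2] at hxy
    have e1 : x ∈ G0 y ∪ H0 y := u y hy1 hy2 ▸ hne
    have e2 : y ∈ G0 x ∪ H0 x := u x hx1 hx2 ▸ hne.symm
    have e3 := (cut_core (a := b) (b := a) (fun x T h1 h2 h4 h5 h6 => h3 x T h1 h2 h4 h6 h5)
      (oH x hx1 hx2) (oG x hx1 hx2) (oH y hy1 hy2) (oG y hy1 hy2) (bH x hx1 hx2)
      (bH y hy1 hy2) (aG x hx1 hx2) (aG y hy1 hy2) (dG x hx1 hx2).symm (dG y hy1 hy2).symm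
      (by rw [union_comm]; exact u x hx1 hx2)
      (by rw [union_comm]; exact u y hy1 hy2) (e1.resolve_left hxy)).2
    exact e2.resolve_right e3
  let r : Y → Y → Prop := fun x y => x ∈ G y
  have : IsStrictTotalOrder Y r :=
    { irrefl := hirr
      trans := fun x y z hxy hyz => hsub y z hyz hxy
      trichotomous := fun x y h1 h2 => by
        by_contra hne
        exact h2 (htri x y hne h1) }
  let _ : LinearOrder Y := linearOrderOfSTO r
  have hIio : ∀ y : Y, Iio y = G y := fun y => rfl
  have hIic : ∀ y : Y, Iic y = insert y (G y) := by
    intro y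
    ext z
    rw [mem_Iic, le_iff_eq_or_lt]
    rfl
  refine arc_of_order (a := a) (b := b) (fun y => by rw [hIio]; exact hop y) (fun y => ?_) ?_ ?_ hab
  · rw [← compl_Iic, hIic]; exact (hcl y).isOpen_compl
  · intro y
    by_cases h : y = a
    · exact h.ge
    · exact le_of_lt (haG y h)
  · intro y
    by_cases h : y = b
    · exact h.le
    · refine le_of_lt ?_
      show y ∈ G b
      rw [Gb]; exact h


section circle
variable {X : Type*} [TopologicalSpace X]

lemma sep_pair [T1Space X] {a b : X} (h : ¬ IsPreconnected ({a, b}ᶜ : Set X)) :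
    ∃ U V : Set X, IsOpen U ∧ IsOpen V ∧ U.Nonempty ∧ V.Nonempty ∧ Disjoint U V ∧
      U ∪ V = {a, b}ᶜ := by
  unfold IsPreconnected at h
  push Not at h
  obtain ⟨u, v, hu, hv, hcov, hun, hvn, hemp⟩ := h
  have ho : IsOpen ({a, b}ᶜ : Set X) := (toFinite {a, b}).isClosed.isOpen_compl
  refine ⟨{a, b}ᶜ ∩ u, {a, b}ᶜ ∩ v, ho.inter hu, ho.inter hv, hun, hvn, ?_, ?_⟩
  · rw [disjoint_left]
    rintro z ⟨h1, h2⟩ ⟨-, h3⟩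
    exact (hemp ▸ (⟨h1, h2, h3⟩ : z ∈ {a, b}ᶜ ∩ (u ∩ v)) : z ∈ (∅ : Set X))
  · rw [← inter_union_distrib_left]
    exact inter_eq_left.2 hcov

lemma half_empty {U V G H : Set X} {a b x y : X} (oU : IsOpen U) (oV : IsOpen V) (oG : IsOpen G)
    (oH : IsOpen H) (dU : Disjoint U V) (uU : U ∪ V = {a, b}ᶜ) (dG : Disjoint G H)
    (uG : G ∪ H = {x, y}ᶜ) (hx : x ∈ U) (hy : y ∈ V) (ha : a ∈ G) (hb : b ∈ G)
    (hc : IsPreconnected ({x}ᶜ : Set X)) : H ∩ U = ∅ := by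
  by_contra hne
  obtain ⟨w, hw⟩ := nonempty_iff_ne_empty.2 hne
  have hwx : w ≠ x := by
    rintro rfl
    have : w ∈ ({w, y}ᶜ : Set X) := uG ▸ Or.inr hw.1
    exact this (.inl rfl)
  have hyx : y ≠ x := by
    rintro rfl
    exact disjoint_left.1 dU hx hy
  obtain ⟨z, -, ⟨hzH, hzU⟩, hz⟩ := hc (H ∩ U) (G ∪ V) (oH.inter oU) (oG.union oV) (by
    intro z hz
    by_cases hzy : z = y
    · right; right; rw [hzy]; exact hy
    have : z ∈ G ∪ H := by
      rw [uG]; rintro (h | h)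
      exacts [hz h, hzy h]
    rcases this with h1 | h1
    · exact .inr (.inl h1)
    · have : z ∈ U ∪ V := by
        rw [uU]; rintro (h | h)
        · exact disjoint_left.1 dG ha (h ▸ h1)
        · rw [mem_singleton_iff] at h
          exact disjoint_left.1 dG hb (h ▸ h1)
      rcases this with h2 | h2
      · exact .inl ⟨h1, h2⟩
      · exact .inr (.inr h2)) ⟨w, hwx, hw⟩ ⟨y, hyx, .inr hy⟩
  rcases hz with hz | hz
  · exact disjoint_left.1 dG hz hzH
  · exact disjoint_left.1 dU hzU hz

lemma not_same {U V G H : Set X} {a b x y : X} (oU : IsOpen U) (oV : IsOpen V) (oG : IsOpen G)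
    (oH : IsOpen H) (dU : Disjoint U V) (uU : U ∪ V = {a, b}ᶜ) (dG : Disjoint G H)
    (uG : G ∪ H = {x, y}ᶜ) (hx : x ∈ U) (hy : y ∈ V) (nH : H.Nonempty)
    (hc : ∀ x : X, IsPreconnected ({x}ᶜ : Set X)) : ¬ (a ∈ G ∧ b ∈ G) := by
  rintro ⟨ha, hb⟩
  have h1 := half_empty oU oV oG oH dU uU dG uG hx hy ha hb (hc x)
  have h2 := half_empty oV oU oG oH dU.symm (by rw [union_comm]; exact uU) dG
    (by rw [pair_comm]; exact uG) hy hx ha hb (hc y)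
  obtain ⟨z, hz⟩ := nH
  have : z ∈ U ∪ V := by
    rw [uU]; rintro (h | h)
    · exact disjoint_left.1 dG ha (h ▸ hz)
    · rw [mem_singleton_iff] at h
      exact disjoint_left.1 dG hb (h ▸ hz)
  rcases this with h | h
  · exact (h1 ▸ (⟨hz, h⟩ : z ∈ H ∩ U) : z ∈ (∅ : Set X))
  · exact (h2 ▸ (⟨hz, h⟩ : z ∈ H ∩ V) : z ∈ (∅ : Set X))

lemma half_conn {U V : Set X} {a b : X} (hab : a ≠ b) (oU : IsOpen U) (oV : IsOpen V)
    (dU : Disjoint U V) (uU : U ∪ V = {a, b}ᶜ)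
    (hc : IsPreconnected ({b}ᶜ : Set X)) : IsPreconnected (insert a U) := by
  have hUn : ∀ z ∈ U, z ≠ a ∧ z ≠ b := by
    intro z hz
    have : z ∈ ({a, b}ᶜ : Set X) := uU ▸ Or.inl hz
    simpa using this
  have key : ∀ u v : Set X, IsOpen u → IsOpen v → insert a U ⊆ u ∪ v →
      (insert a U ∩ v).Nonempty → a ∈ u → (insert a U ∩ (u ∩ v)).Nonempty := by
    intro u v hu hv hcov ⟨w, hw, hwv⟩ hau
    by_contra hemp
    have hwU : w ∈ U := by
      rcases hw with rfl | hw
      · exact absurd ⟨w, .inl rfl, hau, hwv⟩ hemp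
      · exact hw
    obtain ⟨z, -, ⟨hzv, hzU⟩, hz⟩ := hc (v ∩ U) (u ∪ V) (hv.inter oU) (hu.union oV) (by
      intro z hz
      by_cases hza : z = a
      · exact .inr (.inl (hza ▸ hau))
      have : z ∈ U ∪ V := by
        rw [uU]; rintro (h | h)
        exacts [hza h, hz h]
      rcases this with h | h
      · rcases hcov (.inr h) with h1 | h1
        · exact .inr (.inl h1)
        · exact .inl ⟨h1, h⟩
      · exact .inr (.inr h)) ⟨w, (hUn w hwU).2, hwv, hwU⟩ ⟨a, hab, .inl hau⟩
    rcases hz with hz | hz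
    · exact hemp ⟨z, .inr hzU, hz, hzv⟩
    · exact disjoint_left.1 dU hzU hz
  intro u v hu hv hcov hun hvn
  rcases hcov (.inl rfl) with h | h
  · exact key u v hu hv hcov hvn h
  · rw [inter_comm u v]
    exact key v u hv hu (by rwa [union_comm]) hun h

lemma arc_half [T2Space X] [SecondCountableTopology X] {U V : Set X} {a b : X} (hab : a ≠ b)
    (hc : ∀ x : X, IsPreconnected ({x}ᶜ : Set X))
    (hs : ∀ x y : X, x ≠ y → ¬ IsPreconnected ({x, y}ᶜ : Set X))
    (oU : IsOpen U) (oV : IsOpen V) (nU : U.Nonempty) (nV : V.Nonempty)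
    (dU : Disjoint U V) (uU : U ∪ V = {a, b}ᶜ) :
    ∃ f : X → ℝ, ContinuousOn f Vᶜ ∧ InjOn f Vᶜ ∧ f '' Vᶜ = Icc 0 1 ∧ f a = 0 ∧ f b = 1 := by
  classical
  have haV : a ∉ V := fun h => by
    have : a ∈ ({a, b}ᶜ : Set X) := uU ▸ Or.inr h
    simp at this
  have hbV : b ∉ V := fun h => by
    have : b ∈ ({a, b}ᶜ : Set X) := uU ▸ Or.inr h
    simp at this
  have haU : a ∉ U := fun h => by
    have : a ∈ ({a, b}ᶜ : Set X) := uU ▸ Or.inl h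
    simp at this
  have hbU : b ∉ U := fun h => by
    have : b ∈ ({a, b}ᶜ : Set X) := uU ▸ Or.inl h
    simp at this
  have hmem : ∀ z ∈ Vᶜ, z ≠ a → z ≠ b → z ∈ U := by
    intro z hz h1 h2
    have : z ∈ U ∪ V := by rw [uU]; rintro (h | h); exacts [h1 h, h2 h]
    exact this.resolve_right hz
  obtain ⟨y, hy⟩ := nV
  obtain ⟨x0, hx0⟩ := nU
  have hAeq : insert a U ∪ insert b U = Vᶜ := by
    ext z
    constructor
    · rintro ((rfl | h) | (rfl | h))
      exacts [haV, disjoint_left.1 dU h, hbV, disjoint_left.1 dU h]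
    · intro hz
      by_cases h1 : z = a
      · exact .inl (.inl h1)
      by_cases h2 : z = b
      · exact .inr (.inl h2)
      exact .inl (.inr (hmem z hz h1 h2))
  have hApre : IsPreconnected Vᶜ := by
    rw [← hAeq]
    exact (half_conn hab oU oV dU uU (hc b)).union x0 (.inr hx0) (.inr hx0)
      (half_conn hab.symm oU oV dU (by rw [pair_comm]; exact uU) (hc a))
  have : PreconnectedSpace (Vᶜ : Set X) := Subtype.preconnectedSpace hApre
  obtain ⟨f, hf, hfi, hfr, hfa, hfb⟩ := arc_type (Y := (Vᶜ : Set X)) (a := ⟨a, haV⟩) (b := ⟨b, hbV⟩)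
    (fun h => hab (congrArg Subtype.val h)) (by
      rintro ⟨x, hx⟩ hxa hxb
      have hxU : x ∈ U := hmem x hx (fun h => hxa (Subtype.ext h)) (fun h => hxb (Subtype.ext h))
      have hxy : x ≠ y := by rintro rfl; exact hx hy
      obtain ⟨G, H, oG, oH, nG, nH, dG, uG⟩ := sep_pair (hs x y hxy)
      have k1 := not_same oU oV oG oH dU uU dG uG hxU hy nH hc
      have k2 := not_same oU oV oH oG dU uU dG.symm (by rw [union_comm]; exact uG) hxU hy nG hc
      have haG : a ∈ G ∪ H := by
        rw [uG]; rintro (h | h)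
        exacts [haU (h ▸ hxU), haV (h ▸ hy)]
      have hbG : b ∈ G ∪ H := by
        rw [uG]; rintro (h | h)
        · exact hbU (h ▸ hxU)
        · rw [mem_singleton_iff] at h
          exact hbV (h ▸ hy)
      have build : ∀ G H : Set X, IsOpen G → IsOpen H → Disjoint G H → G ∪ H = {x, y}ᶜ → a ∈ G →
          b ∈ H → ∃ G' H' : Set (Vᶜ : Set X), IsOpen G' ∧ IsOpen H' ∧ ⟨a, haV⟩ ∈ G' ∧
            ⟨b, hbV⟩ ∈ H' ∧ Disjoint G' H' ∧ G' ∪ H' = {⟨x, hx⟩}ᶜ := by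
        intro G H oG oH dG uG ha hb
        refine ⟨Subtype.val ⁻¹' G, Subtype.val ⁻¹' H, oG.preimage continuous_subtype_val,
          oH.preimage continuous_subtype_val, ha, hb, dG.preimage _, ?_⟩
        rw [← preimage_union, uG]
        ext ⟨z, hz⟩
        have hzy : z ≠ y := by rintro rfl; exact hz hy
        simp [hzy]
      rcases haG with h1 | h1 <;> rcases hbG with h2 | h2
      · exact absurd ⟨h1, h2⟩ k1
      · exact build G H oG oH dG uG h1 h2
      · exact build H G oH oG dG.symm (by rw [union_comm]; exact uG) h1 h2
      · exact absurd ⟨h1, h2⟩ k2)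
    (by
      rintro ⟨x, hx⟩ T oT cT hxT haT hbT
      by_contra hne
      obtain ⟨w, hw⟩ := nonempty_iff_ne_empty.2 hne
      obtain ⟨O, oO, rfl⟩ := isOpen_induced_iff.1 oT
      obtain ⟨C, cC, hC⟩ := isClosed_induced_iff.1 cT
      have hC' : ∀ z (hz : z ∈ Vᶜ), z ∈ C ↔ z = x ∨ z ∈ O := by
        intro z hz
        have := Set.ext_iff.1 hC ⟨z, hz⟩
        simpa using this
      have hwO : (w : X) ∈ O := hw
      have hwx : (w : X) ≠ x := by
        intro h
        exact hxT (show x ∈ O from h ▸ hwO)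
      have hwU : (w : X) ∈ U := hmem w w.2 (fun h => haT (show a ∈ O from h ▸ hwO))
        (fun h => hbT (show b ∈ O from h ▸ hwO))
      obtain ⟨z, hzx, ⟨hzO, hzU⟩, hz⟩ := hc x (O ∩ U) (C ∩ Vᶜ)ᶜ (oO.inter oU)
        (cC.inter oV.isClosed_compl).isOpen_compl (by
          intro z hzx
          by_cases hz : z ∈ C ∩ Vᶜ
          · left
            have hzO := ((hC' z hz.2).1 hz.1).resolve_left hzx
            exact ⟨hzO, hmem z hz.2 (fun h => haT (show a ∈ O from h ▸ hzO))
              (fun h => hbT (show b ∈ O from h ▸ hzO))⟩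
          · exact .inr hz) ⟨w, hwx, hwO, hwU⟩ ⟨y, fun h => hx (h ▸ hy), fun h => h.2 hy⟩
      have hzV : z ∈ Vᶜ := disjoint_left.1 dU hzU
      exact hz ⟨(hC' z hzV).2 (.inr hzO), hzV⟩)
  let F : X → ℝ := fun x => if h : x ∈ Vᶜ then f ⟨x, h⟩ else 0
  have hF : ∀ x (h : x ∈ Vᶜ), F x = f ⟨x, h⟩ := fun x h => dif_pos h
  refine ⟨F, ?_, ?_, ?_, ?_, ?_⟩
  · rw [continuousOn_iff_continuous_domRestrict]
    convert hf using 1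
    ext ⟨x, h⟩
    exact hF x h
  · intro x hx y hy hxy
    rw [hF x hx, hF y hy] at hxy
    exact congrArg Subtype.val (hfi hxy)
  · rw [← hfr]
    ext t
    constructor
    · rintro ⟨x, hx, rfl⟩
      exact ⟨⟨x, hx⟩, (hF x hx).symm⟩
    · rintro ⟨⟨x, hx⟩, rfl⟩
      exact ⟨x, hx, hF x hx⟩
  · rw [hF a haV, hfa]
  · rw [hF b hbV, hfb]

theorem circle_char [T2Space X] [SecondCountableTopology X] [CompactSpace X] [Nontrivial X]
    (hc : ∀ x : X, IsPreconnected ({x}ᶜ : Set X))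
    (hs : ∀ x y : X, x ≠ y → ¬ IsPreconnected ({x, y}ᶜ : Set X)) :
    Nonempty (X ≃ₜ Metric.sphere (0 : ℂ) 1) := by
  classical
  obtain ⟨a, b, hab⟩ := exists_pair_ne X
  obtain ⟨U, V, oU, oV, nU, nV, dU, uU⟩ := sep_pair (hs a b hab)
  obtain ⟨f, hf, fi, fr, fa, fb⟩ := arc_half hab hc hs oU oV nU nV dU uU
  obtain ⟨g, hg, gi, gr, ga, gb⟩ := arc_half hab hc hs oV oU nV nU dU.symm
    (by rw [union_comm]; exact uU)
  have hab' : ∀ z ∈ Vᶜ, z ∈ Uᶜ → z = a ∨ z = b := by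
    intro z h1 h2
    by_contra h
    have : z ∈ U ∪ V := by rw [uU]; exact h
    exact this.elim h2 h1
  have haV : a ∈ Vᶜ := fun h => by
    have : a ∈ ({a, b}ᶜ : Set X) := uU ▸ Or.inr h
    simp at this
  have hbV : b ∈ Vᶜ := fun h => by
    have : b ∈ ({a, b}ᶜ : Set X) := uU ▸ Or.inr h
    simp at this
  have haU : a ∈ Uᶜ := fun h => by
    have : a ∈ ({a, b}ᶜ : Set X) := uU ▸ Or.inl h
    simp at this
  have hbU : b ∈ Uᶜ := fun h => by
    have : b ∈ ({a, b}ᶜ : Set X) := uU ▸ Or.inl h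
    simp at this
  let P : ℝ → ℝ → ℂ := fun σ t => ((2 * t - 1 : ℝ) : ℂ) +
    ((σ * Real.sqrt (1 - (2 * t - 1) ^ 2) : ℝ) : ℂ) * Complex.I
  have Pre : ∀ σ t, (P σ t).re = 2 * t - 1 := by intro σ t; simp [P]
  have Pim : ∀ σ t, (P σ t).im = σ * Real.sqrt (1 - (2 * t - 1) ^ 2) := by intro σ t; simp [P]
  have Pc : ∀ σ, Continuous (P σ) := by intro σ; fun_prop
  let F : X → ℂ := fun x => if x ∈ Vᶜ then P 1 (f x) else P (-1) (g x)
  have FV : ∀ x ∈ Vᶜ, F x = P 1 (f x) := fun x hx => if_pos hx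
  have FU : ∀ x ∈ Uᶜ, F x = P (-1) (g x) := by
    intro x hx
    by_cases h : x ∈ Vᶜ
    · rw [FV x h]
      rcases hab' x h hx with rfl | rfl
      · rw [fa, ga]; simp [P]
      · rw [fb, gb]; norm_num [P]
    · exact if_neg h
  have hcov : ∀ x, x ∈ Vᶜ ∨ x ∈ Uᶜ := by
    intro x
    by_contra h
    push Not at h
    simp only [mem_compl_iff, not_not] at h
    exact disjoint_left.1 dU h.2 h.1
  have Fc : Continuous F := by
    rw [← continuousOn_univ]
    have : (univ : Set X) = Vᶜ ∪ Uᶜ := by ext x; simpa using hcov x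
    rw [this]
    refine ContinuousOn.union_of_isClosed (((Pc 1).comp_continuousOn hf).congr FV)
      (((Pc (-1)).comp_continuousOn hg).congr FU) oV.isClosed_compl oU.isClosed_compl
  have hf01 : ∀ x ∈ Vᶜ, f x ∈ Icc (0 : ℝ) 1 := fun x hx => fr ▸ mem_image_of_mem f hx
  have hg01 : ∀ x ∈ Uᶜ, g x ∈ Icc (0 : ℝ) 1 := fun x hx => gr ▸ mem_image_of_mem g hx
  have hsq : ∀ t ∈ Icc (0 : ℝ) 1, 0 ≤ 1 - (2 * t - 1) ^ 2 := by
    intro t ht; nlinarith [ht.1, ht.2]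
  have hPs : ∀ σ, σ ^ 2 = 1 → ∀ t ∈ Icc (0 : ℝ) 1, P σ t ∈ Metric.sphere (0 : ℂ) 1 := by
    intro σ hσ t ht
    have : ‖P σ t‖ ^ 2 = 1 := by
      rw [Complex.sq_norm, Complex.normSq_apply, Pre, Pim]
      have := Real.sq_sqrt (hsq t ht)
      linear_combination (σ ^ 2) * this + (1 - (2 * t - 1) ^ 2) * hσ
    rw [mem_sphere_zero_iff_norm]
    exact (pow_eq_one_iff_of_nonneg (norm_nonneg _) two_ne_zero).1 this
  have Fs : ∀ x, F x ∈ Metric.sphere (0 : ℂ) 1 := by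
    intro x
    rcases hcov x with h | h
    · rw [FV x h]; exact hPs 1 (by norm_num) _ (hf01 x h)
    · rw [FU x h]; exact hPs (-1) (by norm_num) _ (hg01 x h)
  have cross : ∀ x ∈ Vᶜ, ∀ y ∈ Uᶜ, F x = F y → x = y := by
    intro x hx y hy hxy
    rw [FV x hx, FU y hy] at hxy
    have h1 := congrArg Complex.re hxy
    have h2 := congrArg Complex.im hxy
    rw [Pre, Pre] at h1
    have h1 : f x = g y := by linarith
    rw [Pim, Pim, ← h1] at h2
    have h3 : Real.sqrt (1 - (2 * f x - 1) ^ 2) = 0 := by linarith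
    have h4 := (Real.sqrt_eq_zero (hsq _ (hf01 x hx))).1 h3
    have h5 : f x * (1 - f x) = 0 := by linear_combination h4 / 4
    rcases mul_eq_zero.1 h5 with h6 | h6
    · rw [fi hx haV (h6.trans fa.symm), gi hy haU ((h1.symm.trans h6).trans ga.symm)]
    · have h6 : f x = 1 := by linarith
      rw [fi hx hbV (h6.trans fb.symm), gi hy hbU ((h1.symm.trans h6).trans gb.symm)]
  have Fi : Function.Injective F := by
    intro x y hxy
    rcases hcov x with hx | hx <;> rcases hcov y with hy | hy
    · rw [FV x hx, FV y hy] at hxy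
      have := congrArg Complex.re hxy
      rw [Pre, Pre] at this
      exact fi hx hy (by linarith)
    · exact cross x hx y hy hxy
    · exact (cross y hy x hx hxy.symm).symm
    · rw [FU x hx, FU y hy] at hxy
      have := congrArg Complex.re hxy
      rw [Pre, Pre] at this
      exact gi hx hy (by linarith)
  let Φ : X → Metric.sphere (0 : ℂ) 1 := fun x => ⟨F x, Fs x⟩
  have Φb : Function.Bijective Φ := by
    refine ⟨fun x y h => Fi (congrArg Subtype.val h), ?_⟩
    rintro ⟨z, hz⟩
    have hz1 : z.re ^ 2 + z.im ^ 2 = 1 := by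
      have : ‖z‖ ^ 2 = 1 := by rw [mem_sphere_zero_iff_norm.1 hz]; norm_num
      rw [Complex.sq_norm, Complex.normSq_apply] at this
      linarith
    have ht : (z.re + 1) / 2 ∈ Icc (0 : ℝ) 1 := by
      constructor <;> nlinarith [sq_nonneg z.im]
    have hsq' : Real.sqrt (1 - (2 * ((z.re + 1) / 2) - 1) ^ 2) = |z.im| := by
      rw [← Real.sqrt_sq_eq_abs]; congr 1; linear_combination -hz1
    rcases le_total 0 z.im with h0 | h0
    · obtain ⟨x, hx, hxt⟩ := fr.symm ▸ ht
      refine ⟨x, Subtype.ext ?_⟩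
      show F x = z
      rw [FV x hx, hxt]
      apply Complex.ext
      · rw [Pre]; ring
      · rw [Pim, hsq', abs_of_nonneg h0]; ring
    · obtain ⟨x, hx, hxt⟩ := gr.symm ▸ ht
      refine ⟨x, Subtype.ext ?_⟩
      show F x = z
      rw [FU x hx, hxt]
      apply Complex.ext
      · rw [Pre]; ring
      · rw [Pim, hsq', abs_of_nonpos h0]; ring
  exact ⟨Continuous.homeoOfEquivCompactToT2 (f := Equiv.ofBijective Φ Φb)
    (Fc.subtype_mk Fs)⟩

end circle

theorem Setup.circle {E R : Set ℂ} (h : Setup E R) :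
    Nonempty (↥(frontier R) ≃ₜ Metric.sphere (0 : ℂ) 1) := by
  have hcpt : IsCompact (frontier R) := h.cpt.of_isClosed_subset isClosed_frontier h.Rfr
  have : CompactSpace (frontier R) := isCompact_iff_compactSpace.1 hcpt
  have : Nontrivial (frontier R) := h.frontier_nontrivial.coe_sort
  refine circle_char ?_ ?_
  · rintro ⟨a, ha⟩
    rw [← IsInducing.subtypeVal.isPreconnected_image]
    convert h.frontier_preconn a (h.Rfr ha) using 1
    ext z
    simp
  · rintro ⟨a, ha⟩ ⟨b, hb⟩ hab hcon
    rw [← IsInducing.subtypeVal.isPreconnected_image] at hcon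
    refine h.pair_sep ha hb (fun hh => hab (Subtype.ext hh)) ?_
    convert hcon using 1
    ext z
    simp only [Set.mem_sdiff, mem_insert_iff, mem_singleton_iff, mem_image, mem_compl_iff, Subtype.exists,
      Subtype.mk.injEq]
    constructor
    · rintro ⟨h1, h2⟩; exact ⟨z, h1, h2, rfl⟩
    · rintro ⟨w, h1, h2, rfl⟩; exact ⟨h1, h2⟩

theorem boundary_of_component_is_circle
    (E : Set Plane) (hcpt : IsCompact E) (hconn : IsConnected E)
    (hloc : LocallyConnectedSpace E) (hnontriv : E.Nontrivial)
    (hnosep : ∀ p : Plane, IsPreconnected (E \ {p}))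
    (R : Set Plane) (hR : ∃ x ∈ Eᶜ, R = connectedComponentIn Eᶜ x) :
    Nonempty (↥unitCircle ≃ₜ ↥(frontier R)) := by
  obtain ⟨x, hx, rfl⟩ := hR
  let e : ℂ ≃ₗᵢ[ℝ] Plane := Complex.orthonormalBasisOneI.repr
  let φ : ℂ ≃ₜ Plane := e.toHomeomorph
  have hS : Setup (φ ⁻¹' E) (φ ⁻¹' (connectedComponentIn Eᶜ x)) := by
    refine ⟨?_, ?_, ?_, ?_, ?_, ?_, ?_, ?_, ?_, ?_⟩
    · exact φ.isCompact_preimage.2 hcpt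
    · exact φ.isPreconnected_preimage.2 hconn.isPreconnected
    · intro z hz r hr
      have hnb : (Subtype.val ⁻¹' Metric.ball (φ z) r : Set E) ∈ 𝓝 (⟨φ z, hz⟩ : E) :=
        continuous_subtype_val.continuousAt.preimage_mem_nhds (Metric.ball_mem_nhds _ hr)
      obtain ⟨V, hVs, hVo, hzV, hVc⟩ :=
        locallyConnectedSpace_iff_subsets_isOpen_isConnected.1 hloc _ _ hnb
      refine ⟨φ ⁻¹' (Subtype.val '' V), ?_, ?_, ?_, ?_⟩
      · rintro w ⟨v, hv, hvw⟩
        refine ⟨?_, ?_⟩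
        · show φ w ∈ E
          rw [← hvw]; exact v.2
        · have h1 : dist (v : Plane) (φ z) < r := hVs hv
          rw [hvw] at h1
          have h2 : dist (φ w) (φ z) = dist w z := e.dist_map w z
          rw [h2] at h1
          exact h1
      · exact φ.isPreconnected_preimage.2
          (hVc.isPreconnected.image _ continuous_subtype_val.continuousOn)
      · exact ⟨_, hzV, rfl⟩
      · obtain ⟨O, hO, rfl⟩ := isOpen_induced_iff.1 hVo
        rw [mem_nhdsWithin]
        refine ⟨φ ⁻¹' O, hO.preimage φ.continuous, hzV, ?_⟩
        rintro w ⟨hwO, hwE⟩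
        exact ⟨⟨φ w, hwE⟩, hwO, rfl⟩
    · exact hnontriv.preimage φ.surjective
    · intro p
      have := φ.isPreconnected_preimage.2 (hnosep (φ p))
      convert this using 1
      ext z
      simp
    · exact (hcpt.isClosed.isOpen_compl.connectedComponentIn).preimage φ.continuous
    · exact φ.isPreconnected_preimage.2 isPreconnected_connectedComponentIn
    · exact ⟨φ.symm x, by simpa using mem_connectedComponentIn hx⟩
    · intro z hz
      exact fun hzE => connectedComponentIn_subset Eᶜ x hz hzE
    · rw [← φ.preimage_frontier]
      exact preimage_mono (frontier_comp hcpt.isClosed x)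
  obtain ⟨f⟩ := hS.circle
  rw [← φ.preimage_frontier] at f
  have g : ↥(φ ⁻¹' frontier (connectedComponentIn Eᶜ x)) ≃ₜ
      ↥(frontier (connectedComponentIn Eᶜ x)) := φ.sets rfl
  have k : ↥(Metric.sphere (0 : ℂ) 1) ≃ₜ ↥unitCircle := φ.sets (by
    ext z
    have : ‖φ z‖ = ‖z‖ := e.norm_map z
    simp [this])
  exact ⟨(k.symm.trans f.symm).trans g⟩
end

section
/- If E ⊆ ℝ² is a locally connected continuum and R₁, R₂, … is an infinite sequence of pairwise distinct connected components of ℝ² \ E, then diam(Rₙ) → 0 as n → ∞. -/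
open Set Filter

lemma exp_one_const {X : Type*} [TopologicalSpace X] {S : Set X} (hS : IsPreconnected S)
    {f : X → ℂ} (hf : ContinuousOn f S) (h1 : ∀ x ∈ S, Complex.exp (f x) = 1) :
    ∃ n : ℤ, ∀ x ∈ S, f x = n * (2 * Real.pi * Complex.I) := by
  rcases S.eq_empty_or_nonempty with rfl | ⟨x₀, hx₀⟩
  · exact ⟨0, by simp⟩
  have key : ∀ x ∈ S, ∃ n : ℤ, f x = n * (2 * Real.pi * Complex.I) := fun x hx =>
    Complex.exp_eq_one_iff.1 (h1 x hx)
  obtain ⟨n, hn⟩ := key x₀ hx₀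
  refine ⟨n, fun x hx => ?_⟩
  obtain ⟨m, hm⟩ := key x hx
  suffices m = n by rw [hm, this]
  have hpi : (0:ℝ) < 2 * Real.pi := by positivity
  have him : ∀ (y : X) (k : ℤ), f y = k * (2 * Real.pi * Complex.I) →
      (f y).im / (2 * Real.pi) = k := by
    intro y k hk
    rw [hk]
    simp
  set g : X → ℝ := fun y => (f y).im / (2 * Real.pi) with hg
  have hgc : ContinuousOn g S := by
    exact (Complex.continuous_im.comp_continuousOn hf).div_const _
  have hpre := (hS.image g hgc).ordConnected
  have hgm : g x = m := him x m hm
  have hgn : g x₀ = n := him x₀ n hn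
  have hno : ∀ k : ℤ, (k : ℝ) + 1/2 ∉ g '' S := by
    rintro k ⟨y, hy, hyk⟩
    obtain ⟨l, hl⟩ := key y hy
    have := him y l hl
    have h2 : (l : ℝ) = k + 1/2 := by rw [← hyk, hg]; exact this.symm
    have h3 : (2 * l : ℝ) = 2 * k + 1 := by linarith
    have h4 : 2 * l = 2 * k + 1 := by exact_mod_cast h3
    omega
  have ha : (m:ℝ) ∈ g '' S := ⟨x, hx, hgm⟩
  have hb : (n:ℝ) ∈ g '' S := ⟨x₀, hx₀, hgn⟩
  rcases lt_trichotomy m n with h | h | h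
  · exfalso
    have h' : (m:ℝ) + 1 ≤ n := by exact_mod_cast h
    exact hno m (hpre.out ha hb ⟨by linarith, by linarith⟩)
  · exact h
  · exfalso
    have h' : (n:ℝ) + 1 ≤ m := by exact_mod_cast h
    exact hno n (hpre.out hb ha ⟨by linarith, by linarith⟩)

lemma no_log_circle {g : ℂ → ℂ} (hg : Continuous g) (h0 : ∀ z, g z ≠ 0) (a : ℂ) (c : ℤ) {r : ℝ}
    (hr : 0 < r) (hc : ∀ z, ‖z - a‖ = r → g z = (z - a) ^ c) : c = 0 := by
  have hsc : IsSimplyConnected (univ : Set ℂ) := by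
    have := (convex_univ (𝕜 := ℝ) (E := ℂ)).contractibleSpace univ_nonempty
    exact (inferInstance : SimplyConnectedSpace (univ : Set ℂ))
  obtain ⟨G, hGc, hG⟩ := Complex.exists_continuousOn_eqOn_exp_comp hsc isOpen_univ
    (g := g) hg.continuousOn (by rintro ⟨z, -, hz⟩; exact h0 z hz)
  rw [continuousOn_univ] at hGc
  let p : ℝ → ℂ := fun θ => a + Complex.exp (Real.log r + θ * Complex.I)
  have hpc : Continuous p := by fun_prop
  let h : ℝ → ℂ := fun θ => G (p θ) - c * (Real.log r + θ * Complex.I)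
  have hh : Continuous h := by
    have := hGc.comp hpc
    have h2 : Continuous (fun θ : ℝ => (c:ℂ) * (Real.log r + θ * Complex.I)) := by fun_prop
    exact this.sub h2
  have h1 : ∀ θ, Complex.exp (h θ) = 1 := by
    intro θ
    have e1 : Complex.exp (G (p θ)) = g (p θ) := hG (mem_univ _)
    have e2 : g (p θ) = Complex.exp (Real.log r + θ * Complex.I) ^ c := by
      rw [hc (p θ)]
      · simp [p]
      · simp only [p, add_sub_cancel_left, Complex.norm_exp]
        simp [Real.exp_log hr]
    simp only [h]
    rw [Complex.exp_sub, e1, e2, ← Complex.exp_int_mul, div_self (Complex.exp_ne_zero _)]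
  obtain ⟨n, hn⟩ := exp_one_const isPreconnected_univ hh.continuousOn (fun x _ => h1 x)
  have A := hn 0 (mem_univ _)
  have B := hn (2 * Real.pi) (mem_univ _)
  have P : p (2 * Real.pi) = p 0 := by
    simp only [p]
    congr 1
    rw [Complex.exp_add, Complex.exp_add]
    simp [Complex.exp_two_pi_mul_I]
  simp only [h, P] at A B
  have C : (c : ℂ) * (2 * Real.pi * Complex.I) = 0 := by
    push_cast at A B
    linear_combination A - B
  have := Complex.two_pi_I_ne_zero
  rcases mul_eq_zero.1 C with h | h
  · exact_mod_cast h
  · exact absurd h this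

lemma indep {ι : Type*} (F : Finset ι) {E : Set ℂ} (hE : IsClosed E) (U : ι → Set ℂ) (a : ι → ℂ)
    (haU : ∀ i, a i ∈ U i) (hUo : ∀ i, IsOpen (U i)) (hUf : ∀ i, frontier (U i) ⊆ E)
    (hUb : ∀ i, Bornology.IsBounded (U i)) (hd : ∀ i j, i ≠ j → Disjoint (U i) (U j))
    (c : ι → ℤ) (φ : ℂ → ℂ) (hφ : ContinuousOn φ E) 
    (h : ∀ z ∈ E, Complex.exp (φ z) = ∏ i ∈ F, (z - a i) ^ c i) : ∀ i ∈ F, c i = 0 := by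
  classical
  intro i hi
  obtain ⟨Φ, hΦ⟩ := ContinuousMap.exists_restrict_eq hE ⟨E.domRestrict φ, hφ.domRestrict⟩
  have hΦ' : ∀ z ∈ E, Φ z = φ z := fun z hz => by
    have := congrArg (fun f => f ⟨z, hz⟩) hΦ
    simpa using this
  let g₁ : ℂ → ℂ := fun z => Complex.exp (Φ z) * ∏ j ∈ F.erase i, (z - a j) ^ (- c j)
  let g₂ : ℂ → ℂ := fun z => (z - a i) ^ c i
  let g : ℂ → ℂ := (U i).piecewise g₁ g₂
  have hne : ∀ j ≠ i, ∀ z ∈ closure (U i), z - a j ≠ 0 := by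
    intro j hj z hz h0
    have : z = a j := sub_eq_zero.1 h0
    rw [mem_closure_iff] at hz
    obtain ⟨w, hw, hw'⟩ := hz (U j) (hUo j) (this ▸ haU j)
    exact (hd j i hj).le_bot ⟨hw, hw'⟩
  have hne2 : ∀ z ∉ U i, z - a i ≠ 0 := by
    intro z hz h0
    exact hz (sub_eq_zero.1 h0 ▸ haU i)
  have hg : Continuous g := by
    apply continuous_piecewise
    · intro z hz
      have hzE := hUf i hz
      have hzU : z ∉ U i := by
        have := hz.2
        rwa [(hUo i).interior_eq] at this
      simp only [g₁, g₂]
      rw [hΦ' z hzE, h z hzE, ← Finset.mul_prod_erase F _ hi, mul_assoc, ← Finset.prod_mul_distrib]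
      rw [Finset.prod_eq_one, mul_one]
      intro j hj
      rw [← zpow_add₀ (hne j (Finset.ne_of_mem_erase hj) z hz.1)]
      simp
    · apply ContinuousOn.mul
      · exact (Complex.continuous_exp.comp Φ.continuous).continuousOn
      · apply continuousOn_finsetProd
        intro j hj
        apply ContinuousOn.zpow₀
        · fun_prop
        · intro z hz
          exact Or.inl (hne j (Finset.ne_of_mem_erase hj) z hz)
    · rw [(hUo i).isClosed_compl.closure_eq]
      apply ContinuousOn.zpow₀
      · fun_prop
      · intro z hz
        exact Or.inl (hne2 z hz)
  obtain ⟨M, hM⟩ := (hUb i).subset_ball (a i)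
  have hMp : 0 < M := by
    have := hM (haU i)
    simpa using this
  apply no_log_circle hg _ (a i) (c i) hMp
  · intro z hz
    have hz' : z ∉ U i := fun hzU => by
      have := hM hzU
      rw [Metric.mem_ball, dist_eq_norm] at this
      linarith
    simp [g, hz', g₂]
  · intro z
    by_cases hz : z ∈ U i
    · simp only [g, hz, piecewise_eq_of_mem, g₁]
      apply mul_ne_zero (Complex.exp_ne_zero _)
      rw [Finset.prod_ne_zero_iff]
      intro j hj
      exact zpow_ne_zero _ (hne j (Finset.ne_of_mem_erase hj) z (subset_closure hz))
    · simp only [g, hz, not_false_eq_true, piecewise_eq_of_notMem, g₂]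
      exact zpow_ne_zero _ (hne2 z hz)

lemma same_comp {E : Set ℂ} (hE : IsClosed E) {S : Set ℂ} (hS : IsPreconnected S) (hSE : S ⊆ Eᶜ)
    {a b : ℂ} (ha : a ∈ S) (hb : b ∈ S) :
    ∃ ψ : ℂ → ℂ, ContinuousOn ψ E ∧ ∀ z ∈ E, Complex.exp (ψ z) * (z - b) = z - a := by
  have hne : ∀ x ∈ S, ∀ z ∈ E, z - x ≠ 0 := fun x hx z hz h0 =>
    hSE hx (sub_eq_zero.1 h0 ▸ hz)
  refine hS.induction₂ (fun a b => ∃ ψ : ℂ → ℂ, ContinuousOn ψ E ∧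
    ∀ z ∈ E, Complex.exp (ψ z) * (z - b) = z - a) ?_ ?_ ?_ ha hb
  · intro x hx
    obtain ⟨ε, hε, hball⟩ := Metric.isOpen_iff.1 hE.isOpen_compl x (hSE hx)
    filter_upwards [mem_nhdsWithin_of_mem_nhds (Metric.ball_mem_nhds x hε)] with y hy
    have hslit : ∀ z ∈ E, (z - y) / (z - x) ∈ Complex.slitPlane := by
      intro z hz
      have h0 := hne x hx z hz
      have e : (z - y) / (z - x) = 1 + (x - y) / (z - x) := by field_simp; ring
      rw [e]
      apply Complex.mem_slitPlane_of_norm_lt_one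
      rw [norm_div, div_lt_one (norm_pos_iff.2 h0)]
      have h1 : ‖x - y‖ < ε := by rw [← dist_eq_norm, dist_comm]; exact hy
      have h2 : ε ≤ ‖z - x‖ := by
        by_contra hlt
        push Not at hlt
        exact hball (by rwa [Metric.mem_ball, dist_eq_norm]) hz
      linarith
    refine ⟨fun z => - Complex.log ((z - y) / (z - x)), ?_, ?_⟩
    · apply ContinuousOn.neg
      apply ContinuousOn.clog _ hslit
      apply ContinuousOn.div (by fun_prop) (by fun_prop) (fun z hz => hne x hx z hz)
    · intro z hz
      have h0 := hne x hx z hz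
      have h1 : (z - y) / (z - x) ≠ 0 := Complex.slitPlane_ne_zero (hslit z hz)
      have h2 : z - y ≠ 0 := fun h => h1 (by rw [h, zero_div])
      rw [Complex.exp_neg, Complex.exp_log h1]
      field_simp
  · rintro x y w hx hy hw ⟨f, hf, hf'⟩ ⟨g, hg, hg'⟩
    refine ⟨fun z => f z + g z, hf.add hg, fun z hz => ?_⟩
    rw [Complex.exp_add, mul_assoc, hg' z hz, hf' z hz]
  · rintro x y hx hy ⟨f, hf, hf'⟩
    refine ⟨fun z => - f z, hf.neg, fun z hz => ?_⟩
    rw [← hf' z hz, ← mul_assoc, ← Complex.exp_add]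
    simp

lemma comp_frontier {E : Set ℂ} (hE : IsClosed E) {x : ℂ} :
    frontier (connectedComponentIn Eᶜ x) ⊆ E := by
  intro y hy
  by_contra hyE
  have hyo : IsOpen (connectedComponentIn Eᶜ y) := hE.isOpen_compl.connectedComponentIn
  obtain ⟨w, hw, hw'⟩ := mem_closure_iff.1 hy.1 _ hyo (mem_connectedComponentIn hyE)
  have e : connectedComponentIn Eᶜ x = connectedComponentIn Eᶜ y :=
    (connectedComponentIn_eq hw').trans (connectedComponentIn_eq hw).symm
  have h2 := hy.2
  rw [e, hyo.interior_eq] at h2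
  exact h2 (mem_connectedComponentIn hyE)

lemma half_logs {E U : Set ℂ} (hE : IsClosed E) (hU : IsPreconnected U) (hUE : U ⊆ Eᶜ)
    {u : ℂ} (hu : u ≠ 0) {s t : ℝ} {a b : ℂ} (ha : a ∈ U) (hb : b ∈ U)
    (has : (u * a).re < s) (hbt : t < (u * b).re) :
    ∃ f g : ℂ → ℂ, ContinuousOn f (E ∩ {z | (u * z).re ≤ t}) ∧
      ContinuousOn g (E ∩ {z | s ≤ (u * z).re}) ∧
      (∀ z ∈ E ∩ {z | (u * z).re ≤ t}, Complex.exp (f z) = z - a) ∧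
      (∀ z ∈ E ∩ {z | s ≤ (u * z).re}, Complex.exp (g z) = z - a) := by
  obtain ⟨ψ, hψ, hψ'⟩ := same_comp hE hU hUE ha hb
  have h1 : ∀ z ∈ E ∩ {z | (u * z).re ≤ t}, u * (b - z) ∈ Complex.slitPlane := by
    rintro z ⟨-, hz⟩
    left
    simp only [mem_ofPred_eq] at hz
    rw [mul_sub, Complex.sub_re]
    linarith
  have h2 : ∀ z ∈ E ∩ {z | s ≤ (u * z).re}, u * (z - a) ∈ Complex.slitPlane := by
    rintro z ⟨-, hz⟩
    left
    simp only [mem_ofPred_eq] at hz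
    rw [mul_sub, Complex.sub_re]
    linarith
  refine ⟨fun z => Complex.log (u * (b - z)) - Complex.log (-u) + ψ z,
    fun z => Complex.log (u * (z - a)) - Complex.log u, ?_, ?_, ?_, ?_⟩
  · refine ContinuousOn.add (ContinuousOn.sub (ContinuousOn.clog (by fun_prop) h1)
      continuousOn_const) (hψ.mono inter_subset_left)
  · exact ContinuousOn.sub (ContinuousOn.clog (by fun_prop) h2) continuousOn_const
  · intro z hz
    rw [Complex.exp_add, Complex.exp_sub, Complex.exp_log (Complex.slitPlane_ne_zero (h1 z hz)),
      Complex.exp_log (neg_ne_zero.2 hu), ← hψ' z hz.1]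
    field_simp
    ring
  · intro z hz
    rw [Complex.exp_sub, Complex.exp_log (Complex.slitPlane_ne_zero (h2 z hz)), Complex.exp_log hu]
    field_simp

lemma cover {E : Set ℂ} (hE : IsCompact E) (hloc : LocallyConnectedSpace E) (u : ℂ) {s m t : ℝ}
    (hsm : s < m) (hmt : m < t) :
    ∃ (T : Finset ℂ) (V : ℂ → Set ℂ),
      (∀ p ∈ T, IsPreconnected (V p) ∧ V p ⊆ E ∩ {z | s < (u * z).re ∧ (u * z).re < t}) ∧
      ∀ z ∈ E, (u * z).re = m → ∃ p ∈ T, z ∈ V p := by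
  have hc : Continuous (fun z : ℂ => (u * z).re) := by fun_prop
  let K : Set ℂ := E ∩ {z | (u * z).re = m}
  have hK : IsCompact K := hE.inter_right (isClosed_eq hc continuous_const)
  have key : ∀ p ∈ K, ∃ V : Set ℂ, V ∈ nhdsWithin p K ∧ IsPreconnected V ∧
      V ⊆ E ∩ {z | s < (u * z).re ∧ (u * z).re < t} := by
    rintro p ⟨hpE, hpm⟩
    let W : Set E := {x | s < (u * (x:ℂ)).re ∧ (u * (x:ℂ)).re < t}
    have hWo : IsOpen W := 
      (isOpen_lt continuous_const (hc.comp continuous_subtype_val)).inter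
        (isOpen_lt (hc.comp continuous_subtype_val) continuous_const)
    have hpW : (⟨p, hpE⟩ : E) ∈ W := by
      simp only [mem_ofPred_eq] at hpm
      simp only [W, mem_ofPred_eq, hpm]
      exact ⟨hsm, hmt⟩
    have hn := connectedComponentIn_mem_nhds (hWo.mem_nhds hpW)
    refine ⟨(↑) '' connectedComponentIn W ⟨p, hpE⟩, ?_, ?_, ?_⟩
    · have : ((↑) '' connectedComponentIn W ⟨p, hpE⟩ : Set ℂ) ∈ nhdsWithin p E := by
        rw [nhdsWithin_eq_map_subtype_coe hpE]
        exact image_mem_map hn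
      exact nhdsWithin_mono p inter_subset_left this
    · exact isPreconnected_connectedComponentIn.image _ continuous_subtype_val.continuousOn
    · rintro _ ⟨x, hx, rfl⟩
      exact ⟨x.2, (connectedComponentIn_subset W _ hx : x ∈ W)⟩
  choose! V hV1 hV2 hV3 using key
  obtain ⟨T, hT, hT'⟩ := hK.elim_nhdsWithin_subcover V hV1
  refine ⟨T, V, fun p hp => ⟨hV2 p (hT p hp), hV3 p (hT p hp)⟩, fun z hz hzm => ?_⟩
  have := hT' (show z ∈ K from ⟨hz, hzm⟩)
  simpa using this

lemma core {E : Set ℂ} (hE : IsCompact E) (hloc : LocallyConnectedSpace E) {u : ℂ} (hu : u ≠ 0)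
    {s t : ℝ} (hst : s < t) :
    {U : Set ℂ | (∃ x ∈ Eᶜ, U = connectedComponentIn Eᶜ x) ∧ Bornology.IsBounded U ∧
      (∃ a ∈ U, (u * a).re < s) ∧ (∃ b ∈ U, t < (u * b).re)}.Finite := by
  set 𝒰 := {U : Set ℂ | (∃ x ∈ Eᶜ, U = connectedComponentIn Eᶜ x) ∧ Bornology.IsBounded U ∧
      (∃ a ∈ U, (u * a).re < s) ∧ (∃ b ∈ U, t < (u * b).re)} with h𝒰
  obtain ⟨m, hsm, hmt⟩ := exists_between hst
  obtain ⟨T, V, hV, hcov⟩ := cover hE hloc u hsm hmt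
  have hEc := hE.isClosed
  have hpre : ∀ U : 𝒰, IsPreconnected (U : Set ℂ) := by
    rintro ⟨U, ⟨x, hx, rfl⟩, -⟩
    exact isPreconnected_connectedComponentIn
  have hsub : ∀ U : 𝒰, (U : Set ℂ) ⊆ Eᶜ := by
    rintro ⟨U, ⟨x, hx, rfl⟩, -⟩
    exact connectedComponentIn_subset _ _
  have hopen : ∀ U : 𝒰, IsOpen (U : Set ℂ) := by
    rintro ⟨U, ⟨x, hx, rfl⟩, -⟩
    exact hEc.isOpen_compl.connectedComponentIn
  have hfr : ∀ U : 𝒰, frontier (U : Set ℂ) ⊆ E := by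
    rintro ⟨U, ⟨x, hx, rfl⟩, -⟩
    exact comp_frontier hEc
  have hdis : ∀ U U' : 𝒰, U ≠ U' → Disjoint (U : Set ℂ) (U' : Set ℂ) := by
    rintro ⟨U, ⟨x, hx, rfl⟩, h⟩ ⟨U', ⟨x', hx', rfl⟩, h'⟩ hne
    rw [Set.disjoint_left]
    intro w hw hw'
    apply hne
    apply Subtype.ext
    exact (connectedComponentIn_eq hw).trans (connectedComponentIn_eq hw').symm
  have hab : ∀ U : 𝒰, ∃ a : ℂ, a ∈ (U : Set ℂ) ∧
      ∃ f g : ℂ → ℂ, ContinuousOn f (E ∩ {z | (u * z).re ≤ t}) ∧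
      ContinuousOn g (E ∩ {z | s ≤ (u * z).re}) ∧
      (∀ z ∈ E ∩ {z | (u * z).re ≤ t}, Complex.exp (f z) = z - a) ∧
      (∀ z ∈ E ∩ {z | s ≤ (u * z).re}, Complex.exp (g z) = z - a) := by
    intro U
    obtain ⟨-, -, ⟨a, ha, ha'⟩, ⟨b, hb, hb'⟩⟩ := U.2
    exact ⟨a, ha, half_logs hEc (hpre U) (hsub U) hu ha hb ha' hb'⟩
  choose a haU f g hf hg hfe hge using hab
  have hD : ∀ (U : 𝒰) (p : T), ∃ n : ℤ, ∀ z ∈ V p, f U z - g U z = n * (2 * Real.pi * Complex.I) := by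
    intro U p
    obtain ⟨h1, h2⟩ := hV p p.2
    have hl : V p ⊆ E ∩ {z | (u * z).re ≤ t} := fun z hz => ⟨(h2 hz).1, (h2 hz).2.2.le⟩
    have hr : V p ⊆ E ∩ {z | s ≤ (u * z).re} := fun z hz => ⟨(h2 hz).1, (h2 hz).2.1.le⟩
    refine exp_one_const h1 (f := fun z => f U z - g U z)
      (((hf U).mono hl).sub ((hg U).mono hr)) ?_
    intro z hz
    rw [Complex.exp_sub, hfe U z (hl hz), hge U z (hr hz), div_self]
    rw [← hge U z (hr hz)]
    exact Complex.exp_ne_zero _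
  choose D hD using hD
  have hli : LinearIndependent ℤ D := by
    rw [linearIndependent_iff']
    intro F c hc
    let φ₁ : ℂ → ℂ := fun z => ∑ U ∈ F, c U * f U z
    let φ₂ : ℂ → ℂ := fun z => ∑ U ∈ F, c U * g U z
    have hEq : ∀ z ∈ E, (u * z).re = m → φ₁ z = φ₂ z := by
      intro z hz hzm
      obtain ⟨p, hp, hzp⟩ := hcov z hz hzm
      have e : ∑ U ∈ F, c U * D U ⟨p, hp⟩ = 0 := by
        have := congrFun hc ⟨p, hp⟩
        simpa using this
      rw [← sub_eq_zero]
      simp only [φ₁, φ₂]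
      rw [← Finset.sum_sub_distrib]
      calc ∑ U ∈ F, ((c U : ℂ) * f U z - c U * g U z) 
          = ∑ U ∈ F, ((c U * D U ⟨p, hp⟩ : ℤ) : ℂ) * (2 * Real.pi * Complex.I) := by
            apply Finset.sum_congr rfl
            intro U _
            rw [← mul_sub, hD U ⟨p, hp⟩ z hzp]
            push_cast
            ring
        _ = 0 := by rw [← Finset.sum_mul, ← Int.cast_sum, e]; simp
    classical
    let φ : ℂ → ℂ := fun z => if (u * z).re ≤ m then φ₁ z else φ₂ z
    have hre : Continuous (fun z : ℂ => (u * z).re) := by fun_prop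
    have hcl1 : IsClosed (E ∩ {z | (u * z).re ≤ m}) :=
      hEc.inter (isClosed_le hre continuous_const)
    have hcl2 : IsClosed (E ∩ {z | m ≤ (u * z).re}) :=
      hEc.inter (isClosed_le continuous_const hre)
    have hc1 : ContinuousOn φ₁ (E ∩ {z | (u * z).re ≤ m}) := by
      apply continuousOn_finsetSum
      intro U _
      exact continuousOn_const.mul ((hf U).mono fun z hz => ⟨hz.1, le_trans hz.2 hmt.le⟩)
    have hc2 : ContinuousOn φ₂ (E ∩ {z | m ≤ (u * z).re}) := by
      apply continuousOn_finsetSum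
      intro U _
      exact continuousOn_const.mul ((hg U).mono fun z hz => ⟨hz.1, le_trans hsm.le hz.2⟩)
    have hφ1 : ∀ z ∈ E ∩ {z | (u * z).re ≤ m}, φ z = φ₁ z := fun z hz => if_pos hz.2
    have hφ2 : ∀ z ∈ E ∩ {z | m ≤ (u * z).re}, φ z = φ₂ z := by
      intro z hz
      simp only [φ]
      split_ifs with h
      · exact hEq z hz.1 (le_antisymm h hz.2)
      · rfl
    have hcov' : E = (E ∩ {z | (u * z).re ≤ m}) ∪ (E ∩ {z | m ≤ (u * z).re}) := by
      ext z
      constructor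
      · intro hz
        rcases le_total (u * z).re m with h | h
        · exact Or.inl ⟨hz, h⟩
        · exact Or.inr ⟨hz, h⟩
      · rintro (h | h) <;> exact h.1
    have hφc : ContinuousOn φ E := by
      rw [hcov']
      exact (hc1.congr hφ1).union_of_isClosed (hc2.congr hφ2) hcl1 hcl2
    refine indep F hEc (fun U : 𝒰 => (U : Set ℂ)) a haU hopen hfr (fun U => U.2.2.1) hdis c φ hφc ?_
    intro z hz
    rw [hcov'] at hz
    rcases hz with hz | hz
    · rw [hφ1 z hz, Complex.exp_sum]
      apply Finset.prod_congr rfl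
      intro U _
      rw [Complex.exp_int_mul, hfe U z ⟨hz.1, le_trans hz.2 hmt.le⟩]
    · rw [hφ2 z hz, Complex.exp_sum]
      apply Finset.prod_congr rfl
      intro U _
      rw [Complex.exp_int_mul, hge U z ⟨hz.1, le_trans hsm.le hz.2⟩]
  have := hli.finite
  exact Set.toFinite 𝒰

lemma outside_preconnected {M : ℝ} (hM : 0 < M) : IsPreconnected {z : ℂ | M < ‖z‖} := by
  have h1 : IsPreconnected {z : ℂ | Real.log M < z.re} :=
    (convex_halfSpace_re_gt (Real.log M)).isPreconnected
  have h2 := h1.image Complex.exp Complex.continuous_exp.continuousOn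
  convert h2 using 1
  ext z
  constructor
  · intro hz
    have hz' : M < ‖z‖ := hz
    have h0 : z ≠ 0 := norm_pos_iff.1 (hM.trans hz')
    refine ⟨Complex.log z, ?_, Complex.exp_log h0⟩
    show Real.log M < (Complex.log z).re
    rw [Complex.log_re]
    exact Real.log_lt_log hM hz'
  · rintro ⟨w, hw, rfl⟩
    have hw' : Real.log M < w.re := hw
    show M < ‖Complex.exp w‖
    rw [Complex.norm_exp]
    exact (Real.log_lt_iff_lt_exp hM).1 hw'

lemma main_complex {E : Set ℂ} (hE : IsCompact E) (hloc : LocallyConnectedSpace E)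
    {ε : ℝ} (hε : 0 < ε) :
    {U : Set ℂ | (∃ x ∈ Eᶜ, U = connectedComponentIn Eᶜ x) ∧
      ∃ p ∈ U, ∃ q ∈ U, ε < dist p q}.Finite := by
  obtain ⟨M, hM, hEM⟩ := hE.isBounded.subset_closedBall_lt 0 (0:ℂ)
  have hout : {z : ℂ | M < ‖z‖} ⊆ Eᶜ := by
    intro z hz hzE
    have h1 := hEM hzE
    rw [mem_closedBall_zero_iff] at h1
    exact absurd (show M < ‖z‖ from hz) (not_lt.2 h1)
  let 𝒲 : Set (Set ℂ) := {U | (∃ x ∈ Eᶜ, U = connectedComponentIn Eᶜ x) ∧ ∃ w ∈ U, M < ‖w‖}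
  have hW : 𝒲.Finite := by
    apply Set.Subsingleton.finite
    rintro _ ⟨⟨x, hx, rfl⟩, w, hw, hwM⟩ _ ⟨⟨y, hy, rfl⟩, v, hv, hvM⟩
    have h1 := (outside_preconnected hM).subset_connectedComponentIn (x := w) hwM hout hvM
    exact (connectedComponentIn_eq hw).trans
      ((connectedComponentIn_eq h1).trans (connectedComponentIn_eq hv).symm)
  let δ : ℝ := ε / 4
  have hδ : 0 < δ := by positivity
  let N : ℤ := ⌈M / δ⌉ + 2
  let 𝒰 : ℂ → ℤ → Set (Set ℂ) := fun u j =>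
    {U : Set ℂ | (∃ x ∈ Eᶜ, U = connectedComponentIn Eᶜ x) ∧ Bornology.IsBounded U ∧
      (∃ a ∈ U, (u * a).re < j * δ) ∧ (∃ b ∈ U, (j + 1) * δ < (u * b).re)}
  have hU : ∀ u ≠ 0, ∀ j, (𝒰 u j).Finite := fun u hu j => 
    core hE hloc hu (by nlinarith)
  have hfin : (𝒲 ∪ ⋃ u ∈ ({1, -Complex.I} : Set ℂ), ⋃ j ∈ Set.Icc (-N) N, 𝒰 u j).Finite := by
    refine hW.union (Set.Finite.biUnion (by simp) ?_)
    intro u hu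
    refine Set.Finite.biUnion (Set.finite_Icc _ _) (fun j _ => hU u ?_ j)
    rcases hu with rfl | rfl
    · simp
    · simp
  refine hfin.subset ?_
  rintro U ⟨hUc, p, hp, q, hq, hpq⟩
  by_cases hUM : ∃ w ∈ U, M < ‖w‖
  · exact Or.inl ⟨hUc, hUM⟩
  push Not at hUM
  right
  have hUb : Bornology.IsBounded U :=
    Metric.isBounded_closedBall.subset (fun w hw => mem_closedBall_zero_iff.2 (hUM w hw))
  have key : ∀ u ∈ ({1, -Complex.I} : Set ℂ), ∀ p ∈ U, ∀ q ∈ U, 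
      ε / 2 < (u * q).re - (u * p).re → ∃ j ∈ Set.Icc (-N) N, U ∈ 𝒰 u j := by
    intro u hu p hp q hq h
    have hu1 : ‖u‖ = 1 := by
      rcases hu with rfl | rfl <;> simp
    have hr : |(u * p).re| ≤ M := by
      refine (Complex.abs_re_le_norm _).trans ?_
      rw [norm_mul, hu1, one_mul]
      exact hUM p hp
    have hr' : |(u * p).re / δ| ≤ M / δ := by
      rw [abs_div, abs_of_pos hδ]
      gcongr
    rw [abs_le] at hr'
    have f1 := Int.floor_le ((u * p).re / δ)
    have f2 := Int.lt_floor_add_one ((u * p).re / δ)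
    have f3 := Int.le_ceil (M / δ)
    refine ⟨⌊(u * p).re / δ⌋ + 1, ⟨?_, ?_⟩, hUc, hUb, ⟨p, hp, ?_⟩, ⟨q, hq, ?_⟩⟩
    · have : (-N : ℝ) ≤ ((⌊(u * p).re / δ⌋ + 1 : ℤ) : ℝ) := by
        simp only [N]; push_cast; linarith
      exact_mod_cast this
    · have : ((⌊(u * p).re / δ⌋ + 1 : ℤ) : ℝ) ≤ (N : ℝ) := by
        simp only [N]; push_cast; linarith
      exact_mod_cast this
    · push_cast
      exact (div_lt_iff₀ hδ).1 f2
    · push_cast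
      have := (le_div_iff₀ hδ).1 f1
      have e : ε = 4 * δ := by simp only [δ]; ring
      nlinarith
  have hn : ‖p - q‖ ≤ |(p - q).re| + |(p - q).im| := Complex.norm_le_abs_re_add_abs_im _
  rw [← dist_eq_norm] at hn
  have fin : ∀ u ∈ ({1, -Complex.I} : Set ℂ), ε / 2 < |(u * p).re - (u * q).re| →
      U ∈ ⋃ u ∈ ({1, -Complex.I} : Set ℂ), ⋃ j ∈ Set.Icc (-N) N, 𝒰 u j := by
    intro u hu h
    have : ∃ j ∈ Set.Icc (-N) N, U ∈ 𝒰 u j := by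
      rcases lt_abs.1 h with h | h
      · exact key u hu q hq p hp h
      · exact key u hu p hp q hq (by linarith)
    obtain ⟨j, hj, hj'⟩ := this
    exact Set.mem_biUnion hu (Set.mem_biUnion hj hj')
  by_cases hre : ε / 2 < |(p - q).re|
  · refine fin 1 (by simp) ?_
    simpa using hre
  · refine fin (-Complex.I) (by simp) ?_
    have h3 : ε / 2 < |(p - q).im| := by linarith
    simpa using h3

theorem diam_components_tendsto_zero
    (E : Set Plane) (hcpt : IsCompact E) (hconn : IsConnected E) (hne : E.Nonempty)
    (hloc : LocallyConnectedSpace E)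
    (R : ℕ → Set Plane)
    (hR : ∀ n, ∃ x ∈ Eᶜ, R n = connectedComponentIn Eᶜ x)
    (hdistinct : ∀ m n, m ≠ n → R m ≠ R n) :
    Tendsto (fun n => EMetric.diam (R n)) atTop (nhds 0) := by
  let e : Plane ≃ₗᵢ[ℝ] ℂ := Complex.orthonormalBasisOneI.repr.symm
  let h : Plane ≃ₜ ℂ := e.toHomeomorph
  have hd : ∀ x y, edist (h x) (h y) = edist x y := fun x y => e.isometry x y
  have hE' : IsCompact (h '' E) := hcpt.image h.continuous
  have hloc' : LocallyConnectedSpace (h '' E) :=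
    (h.image E).symm.isOpenEmbedding.locallyConnectedSpace
  have hRinj : Function.Injective (fun n => h '' (R n)) := by
    intro m n hmn
    by_contra hne'
    exact hdistinct m n hne' (h.injective.image_injective hmn)
  rw [ENNReal.tendsto_nhds_zero]
  intro ε hε
  by_cases htop : ε = ⊤
  · simp [htop]
  have hpos : 0 < ε.toReal := ENNReal.toReal_pos hε.ne' htop
  have hfin := (main_complex hE' hloc' hpos).preimage (hRinj.injOn)
  rw [← Nat.cofinite_eq_atTop]
  filter_upwards [hfin.eventually_cofinite_notMem] with n hn
  apply Metric.ediam_le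
  intro x hx y hy
  by_contra hlt
  push Not at hlt
  apply hn
  obtain ⟨w, hw, hRw⟩ := hR n
  refine ⟨⟨h w, ?_, ?_⟩, h x, mem_image_of_mem h hx, h y, mem_image_of_mem h hy, ?_⟩
  · rw [← h.image_compl]
    exact mem_image_of_mem h hw
  · rw [← h.image_compl, ← h.image_connectedComponentIn hw, ← hRw]
  · rw [← hd, edist_dist] at hlt
    exact (ENNReal.lt_ofReal_iff_toReal_lt htop).1 hlt
end
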